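/- Let α, β > −1. There exists a constant C such that ∫_{3π/4}^{π} |T₁f(θ)| dμ(θ) ≤ C ∫₀^π |f(θ)| dμ(θ) for all f ∈ C_c^∞(0,π); however, there is no constant C such that ∫_{0}^{π/4} |T₁f(θ)| dμ(θ) ≤ C ∫₀^π |f(θ)| dμ(θ) for all f ∈ C_c^∞(0,π). (That is, T₁ is bounded from L¹(dμ) to L¹((3π/4,π), dμ) and unbounded from L¹(dμ) to L¹((0,π/4), dμ).) -/

import Mathlib

open MeasureTheory Real Set Filter
open scoped Classical

noncomputable section

/-- The Jacobi measure dμ_{α,β} on (0,π). -/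
def jacobiMeasure (α β : ℝ) : Measure ℝ :=
  (volume.restrict (Set.Ioo 0 π)).withDensity
    (fun θ => ENNReal.ofReal ((Real.sin (θ/2)) ^ (2*α+1) * (Real.cos (θ/2)) ^ (2*β+1)))

/-- The classical Jacobi polynomial `P_n^{(α,β)}`. -/
def jacobiPoly (α β : ℝ) (n : ℕ) (x : ℝ) : ℝ :=
  ∑ k ∈ Finset.range (n+1),
    (Real.Gamma ((n:ℝ)+α+1) / (Real.Gamma (α+(k:ℝ)+1) * (Nat.factorial (n-k)))) *
    (Real.Gamma ((n:ℝ)+β+1) / (Real.Gamma ((n:ℝ)+β-(k:ℝ)+1) * (Nat.factorial k))) *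
    ((x-1)/2)^k * ((x+1)/2)^(n-k)

/-- Normalized trigonometric Jacobi polynomial `𝒫_n(θ) = c_n P_n^{(α,β)}(cos θ)`. -/
def nJacobi (α β : ℝ) (c : ℕ → ℝ) (n : ℕ) (θ : ℝ) : ℝ :=
  c n * jacobiPoly α β n (Real.cos θ)

def jacobiTau (α β : ℝ) : ℝ := (α + β + 1) / 2

/-- `c` is an admissible sequence of (positive) normalizing constants. -/
def JacobiNormalized (α β : ℝ) (c : ℕ → ℝ) : Prop :=
  (∀ n, 0 < c n) ∧
  ∀ n, ∫ θ, (nJacobi α β c n θ)^2 ∂(jacobiMeasure α β) = 1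

/-- The Jacobi-Poisson kernel. -/
def poissonKer (α β : ℝ) (c : ℕ → ℝ) (t θ φ : ℝ) : ℝ :=
  ∑' n : ℕ, Real.exp (-t * |(n:ℝ) + jacobiTau α β|) * nJacobi α β c n θ * nJacobi α β c n φ

/-- The Riesz-Jacobi kernel of order `N`. -/
def rieszKer (α β : ℝ) (c : ℕ → ℝ) (N : ℕ) (θ φ : ℝ) : ℝ :=
  (1 / Real.Gamma (N:ℝ)) *
    ∫ t in Set.Ioi (0:ℝ), iteratedDeriv N (fun θ' => poissonKer α β c t θ' φ) θ * t ^ (N-1)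

/-- Inner product in `L²(dμ_{α,β})`. -/
def jacobiInner (α β : ℝ) (f g : ℝ → ℝ) : ℝ := ∫ θ, f θ * g θ ∂(jacobiMeasure α β)

/-- The Riesz-Jacobi transform of order `N` on test functions. -/
def rieszTransform (α β : ℝ) (c : ℕ → ℝ) (N : ℕ) (f : ℝ → ℝ) (θ : ℝ) : ℝ :=
  ∑' n : ℕ, |((n:ℝ)+1) + jacobiTau α β| ^ (-(N:ℝ)) *
    jacobiInner α β f (nJacobi α β c (n+1)) *
    iteratedDeriv N (nJacobi α β c (n+1)) θ

/-- `f ∈ C_c^∞(0,π)`. -/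
def IsCcSmooth (f : ℝ → ℝ) : Prop :=
  ContDiff ℝ (⊤ : ℕ∞) f ∧ HasCompactSupport f ∧ tsupport f ⊆ Set.Ioo 0 π

/-- The operator `𝒥^{−1}` (with projection off the possible zero eigenvalue):
`𝒥^{−1}f(θ) = Σ_{n ≥ n₀} |n+τ|^{−2} ⟨f,𝒫_n⟩ 𝒫_n(θ)`, where `n₀ = 0` if `τ ≠ 0`
and `n₀ = 1` if `τ = 0` (i.e. the term with `n + τ = 0` is skipped). -/
def jacobiInvOp (α β : ℝ) (c : ℕ → ℝ) (f : ℝ → ℝ) (θ : ℝ) : ℝ :=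
  ∑' n : ℕ, if (n:ℝ) + jacobiTau α β = 0 then 0 else
    |(n:ℝ) + jacobiTau α β| ^ (-(2:ℝ)) *
      jacobiInner α β f (nJacobi α β c n) * nJacobi α β c n θ

/-- The operator `T₁f(θ) = cot(θ/2) ∂_θ 𝒥^{−1}f(θ)`. -/
def opT1 (α β : ℝ) (c : ℕ → ℝ) (f : ℝ → ℝ) (θ : ℝ) : ℝ :=
  Real.cot (θ/2) * deriv (jacobiInvOp α β c f) θ

def wt (α β θ : ℝ) : ℝ := (Real.sin (θ/2)) ^ (2*α+1) * (Real.cos (θ/2)) ^ (2*β+1)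

def linc (α β x : ℝ) : ℝ := β - α - (α + β + 2) * x

def EE (α β : ℝ) (g : ℝ → ℝ) (x : ℝ) : ℝ := (1 - x^2) * deriv g x + linc α β x * g x

def flux (α β : ℝ) (g : ℝ → ℝ) (θ : ℝ) : ℝ :=
  -2 * ((Real.sin (θ/2)) ^ (2*α+2) * (Real.cos (θ/2)) ^ (2*β+2)) * g (Real.cos θ)

lemma sin_half_pos {θ : ℝ} (h : θ ∈ Ioo 0 π) : 0 < Real.sin (θ/2) :=
  Real.sin_pos_of_pos_of_lt_pi (by linarith [h.1]) (by linarith [h.2, Real.pi_pos])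

lemma cos_half_pos {θ : ℝ} (h : θ ∈ Ioo 0 π) : 0 < Real.cos (θ/2) :=
  Real.cos_pos_of_mem_Ioo ⟨by linarith [h.1, Real.pi_pos], by linarith [h.2]⟩

lemma wt_pos (α β : ℝ) {θ : ℝ} (h : θ ∈ Ioo 0 π) : 0 < wt α β θ :=
  mul_pos (Real.rpow_pos_of_pos (sin_half_pos h) _) (Real.rpow_pos_of_pos (cos_half_pos h) _)

lemma wt_meas (α β : ℝ) : Measurable (wt α β) := by
  unfold wt; fun_prop

lemma jm_eq (α β : ℝ) : jacobiMeasure α β =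
  (volume.restrict (Set.Ioo 0 π)).withDensity (fun θ => ENNReal.ofReal (wt α β θ)) := rfl

lemma integral_jm (α β : ℝ) (h : ℝ → ℝ) :
    ∫ θ, h θ ∂(jacobiMeasure α β) = ∫ θ in Ioo 0 π, wt α β θ * h θ := by
  rw [jm_eq, integral_withDensity_eq_integral_toReal_smul (wt_meas α β).ennreal_ofReal
    (by simp)]
  refine setIntegral_congr_fun measurableSet_Ioo (fun θ hθ => ?_)
  simp [ENNReal.toReal_ofReal (wt_pos α β hθ).le]

lemma setIntegral_jm (α β : ℝ) (h : ℝ → ℝ) (s : Set ℝ) (hs : MeasurableSet s) (hsub : s ⊆ Ioo 0 π) :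
    ∫ θ in s, h θ ∂(jacobiMeasure α β) = ∫ θ in s, wt α β θ * h θ := by
  rw [← integral_indicator hs, integral_jm, ← integral_indicator hs,
    ← integral_indicator measurableSet_Ioo]
  congr 1
  ext θ
  by_cases h1 : θ ∈ s
  · simp [h1, hsub h1, indicator]
  · simp [h1, indicator]

lemma integrable_jm (α β : ℝ) (h : ℝ → ℝ) :
    Integrable h (jacobiMeasure α β) ↔ IntegrableOn (fun θ => wt α β θ * h θ) (Ioo 0 π) := by
  rw [jm_eq, integrable_withDensity_iff_integrable_smul' (wt_meas α β).ennreal_ofReal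
    (by simp)]
  refine integrableOn_congr_fun (fun θ hθ => ?_) measurableSet_Ioo
  simp [ENNReal.toReal_ofReal (wt_pos α β hθ).le]

lemma integrable_cos (α β : ℝ) [IsFiniteMeasure (jacobiMeasure α β)] {h : ℝ → ℝ} (hh : Continuous h) :
    Integrable (fun θ => h (Real.cos θ)) (jacobiMeasure α β) := by
  obtain ⟨C, hC⟩ := (isCompact_Icc (a := (-1:ℝ)) (b := 1)).exists_bound_of_continuousOn hh.continuousOn
  refine Integrable.of_bound (hh.comp Real.continuous_cos).aestronglyMeasurable C
    (Eventually.of_forall fun θ => hC _ ⟨Real.neg_one_le_cos θ, Real.cos_le_one θ⟩)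

lemma flux_hasDerivAt (α β : ℝ) {g : ℝ → ℝ} (hg : ContDiff ℝ 1 g) {θ : ℝ} (hθ : θ ∈ Ioo 0 π) :
    HasDerivAt (flux α β g) (wt α β θ * EE α β g (Real.cos θ)) θ := by
  have hs := sin_half_pos hθ
  have hc := cos_half_pos hθ
  have hh : HasDerivAt (fun θ : ℝ => θ/2) (1/2) θ := (hasDerivAt_id θ).div_const 2
  have h1 : HasDerivAt (fun θ : ℝ => Real.sin (θ/2)) (Real.cos (θ/2) * (1/2)) θ := hh.sin
  have h2 : HasDerivAt (fun θ : ℝ => Real.cos (θ/2)) (-Real.sin (θ/2) * (1/2)) θ := hh.cos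
  have h3 := h1.rpow_const (p := 2*α+2) (Or.inl hs.ne')
  have h4 := h2.rpow_const (p := 2*β+2) (Or.inl hc.ne')
  have h5 : HasDerivAt g (deriv g (Real.cos θ)) (Real.cos θ) :=
    (hg.differentiable (by simp) _).hasDerivAt
  have h6 := h5.comp θ (Real.hasDerivAt_cos θ)
  have h7 := ((h3.mul h4).const_mul (-2)).mul h6
  refine h7.congr_deriv ?_
  have e1 : Real.sin θ = 2 * Real.sin (θ/2) * Real.cos (θ/2) := by
    rw [← Real.sin_two_mul]; congr 1; ring
  have e2 : Real.cos θ = 1 - 2 * Real.sin (θ/2)^2 := by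
    have := Real.cos_two_mul (θ/2)
    rw [Real.cos_sq'] at this
    rw [show 2 * (θ/2) = θ by ring] at this; linarith
  have e3 : Real.cos (θ/2)^2 = 1 - Real.sin (θ/2)^2 := Real.cos_sq' _
  have a1 : Real.sin (θ/2) ^ (2*α+2) = Real.sin (θ/2) ^ (2*α+1) * Real.sin (θ/2) := by
    rw [← Real.rpow_add_one hs.ne']; congr 1; ring
  have a2 : Real.cos (θ/2) ^ (2*β+2) = Real.cos (θ/2) ^ (2*β+1) * Real.cos (θ/2) := by
    rw [← Real.rpow_add_one hc.ne']; congr 1; ring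
  rw [show 2*α+2-1 = 2*α+1 by ring, show 2*β+2-1=2*β+1 by ring]
  simp only [wt, EE, linc, Function.comp, a1, a2, Pi.mul_apply]
  generalize Real.sin (θ/2) ^ (2*α+1) = A
  generalize Real.cos (θ/2) ^ (2*β+1) = B
  generalize deriv g (Real.cos θ) = d
  generalize g (Real.cos θ) = y
  rw [e1, e2]
  generalize Real.sin (θ/2) = S at *
  generalize Real.cos (θ/2) = Q at *
  linear_combination (-2*A*B*y*(α+1) + 4*A*B*S^2*d) * e3

lemma flux_cont (α β : ℝ) (hα : -1 < α) (hβ : -1 < β) {g : ℝ → ℝ} (hg : Continuous g) :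
    Continuous (flux α β g) := by
  unfold flux
  refine (continuous_const.mul (Continuous.mul ?_ ?_)).mul (hg.comp Real.continuous_cos)
  · exact Continuous.rpow_const (by fun_prop) (fun x => Or.inr (by linarith))
  · exact Continuous.rpow_const (by fun_prop) (fun x => Or.inr (by linarith))

lemma EE_cont (α β : ℝ) {g : ℝ → ℝ} (hg : ContDiff ℝ 1 g) : Continuous (EE α β g) := by
  have := hg.continuous
  have := hg.continuous_deriv (by simp)
  unfold EE linc; fun_prop

lemma flux_zero (α β : ℝ) (hα : -1 < α) (g : ℝ → ℝ) : flux α β g 0 = 0 := by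
  have : Real.sin (0/2) ^ (2*α+2) = 0 := by
    rw [zero_div, Real.sin_zero, Real.zero_rpow (by linarith)]
  simp only [flux, this]; ring

lemma flux_pi (α β : ℝ) (hβ : -1 < β) (g : ℝ → ℝ) : flux α β g π = 0 := by
  have : Real.cos (π/2) ^ (2*β+2) = 0 := by
    rw [Real.cos_pi_div_two, Real.zero_rpow (by linarith)]
  simp only [flux, this]; ring

lemma flux_eq (α β : ℝ) (hα : -1 < α) (hβ : -1 < β) [IsFiniteMeasure (jacobiMeasure α β)]
    {g : ℝ → ℝ} (hg : ContDiff ℝ 1 g) {θ : ℝ} (hθ : θ ∈ Icc 0 π) :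
    flux α β g θ = ∫ t in Ioc 0 θ, wt α β t * EE α β g (Real.cos t) := by
  have h0 : IntegrableOn (fun t => wt α β t * EE α β g (Real.cos t)) (Ioo 0 π) :=
    (integrable_jm α β _).1 (integrable_cos α β (EE_cont α β hg))
  have := intervalIntegral.integral_eq_sub_of_hasDerivAt_of_le (f := flux α β g)
    (f' := fun t => wt α β t * EE α β g (Real.cos t)) hθ.1
    (flux_cont α β hα hβ hg.continuous).continuousOn
    (fun x hx => flux_hasDerivAt α β hg ⟨hx.1, hx.2.trans_le hθ.2⟩)
    (by
      rw [intervalIntegrable_iff_integrableOn_Ioo_of_le hθ.1]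
      exact h0.mono_set (Ioo_subset_Ioo_right hθ.2))
  rw [flux_zero α β hα, sub_zero, intervalIntegral.integral_of_le hθ.1] at this
  exact this.symm

lemma flux_total (α β : ℝ) (hα : -1 < α) (hβ : -1 < β) [IsFiniteMeasure (jacobiMeasure α β)]
    {g : ℝ → ℝ} (hg : ContDiff ℝ 1 g) :
    ∫ θ, EE α β g (Real.cos θ) ∂(jacobiMeasure α β) = 0 := by
  rw [integral_jm, ← integral_Ioc_eq_integral_Ioo, ← flux_eq α β hα hβ hg ⟨Real.pi_pos.le, le_rfl⟩,
    flux_pi α β hβ]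

lemma flux_bound (α β : ℝ) (hα : -1 < α) (hβ : -1 < β) [IsFiniteMeasure (jacobiMeasure α β)]
    {g : ℝ → ℝ} (hg : ContDiff ℝ 1 g) {θ : ℝ} (hθ : θ ∈ Icc 0 π) :
    |flux α β g θ| ≤ ∫ θ, |EE α β g (Real.cos θ)| ∂(jacobiMeasure α β) := by
  have h0 : IntegrableOn (fun t => wt α β t * EE α β g (Real.cos t)) (Ioo 0 π) :=
    (integrable_jm α β _).1 (integrable_cos α β (EE_cont α β hg))
  rw [flux_eq α β hα hβ hg hθ, integral_jm]
  calc _ ≤ ∫ t in Ioc 0 θ, |wt α β t * EE α β g (Real.cos t)| := abs_integral_le_integral_abs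
    _ ≤ ∫ t in Ioc 0 π, |wt α β t * EE α β g (Real.cos t)| := by
        refine setIntegral_mono_set ?_ (Eventually.of_forall fun t => abs_nonneg _)
          (Ioc_subset_Ioc_right hθ.2).eventuallyLE
        rw [integrableOn_Ioc_iff_integrableOn_Ioo]
        exact h0.abs
    _ = _ := by
        rw [integral_Ioc_eq_integral_Ioo]
        refine setIntegral_congr_fun measurableSet_Ioo (fun t ht => ?_)
        simp [abs_mul, abs_of_pos (wt_pos α β ht)]

lemma ibp (α β : ℝ) (hα : -1 < α) (hβ : -1 < β) [IsFiniteMeasure (jacobiMeasure α β)]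
    {G H : ℝ → ℝ} (hG : ContDiff ℝ 2 G) (hH : ContDiff ℝ 1 H) :
    ∫ θ, EE α β (deriv G) (Real.cos θ) * H (Real.cos θ) ∂(jacobiMeasure α β) =
    - ∫ θ, (1 - Real.cos θ ^2) * (deriv G (Real.cos θ) * deriv H (Real.cos θ))
      ∂(jacobiMeasure α β) := by
  have hG' : ContDiff ℝ 1 (deriv G) := by
    have : ContDiff ℝ (1+1) G := by simpa [one_add_one_eq_two] using hG
    exact (contDiff_succ_iff_deriv.1 this).2.2
  have h := flux_total α β hα hβ (hG'.mul hH)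
  have c1 := hG'.continuous
  have c2 := hH.continuous_deriv (by simp)
  have c3 := hH.continuous
  have c4 := EE_cont α β hG'
  have key : ∀ x, EE α β (deriv G * H) x = EE α β (deriv G) x * H x + 
      (1 - x^2) * (deriv G x * deriv H x) := by
    intro x
    have : deriv (deriv G * H) x = deriv (deriv G) x * H x + deriv G x * deriv H x :=
      deriv_mul (hG'.differentiable (by simp) x) (hH.differentiable (by simp) x)
    simp only [EE, this, Pi.mul_apply]; ring
  have h' : ∫ θ, EE α β (deriv G * H) (Real.cos θ) ∂(jacobiMeasure α β) = 0 := h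
  simp_rw [key] at h'
  rw [integral_add] at h'
  · linarith
  · exact integrable_cos α β (h := fun x => EE α β (deriv G) x * H x) (by fun_prop)
  · exact integrable_cos α β (h := fun x => (1 - x^2) * (deriv G x * deriv H x)) (by fun_prop)

lemma phi_hasDerivAt {δ : ℝ} (hδ : 0 < δ) (y : ℝ) :
    HasDerivAt (fun y : ℝ => y / √(y^2+δ^2)) (δ^2 / (√(y^2+δ^2))^3) y := by
  have hp : 0 < y^2+δ^2 := by positivity
  have hs : 0 < √(y^2+δ^2) := Real.sqrt_pos.2 hp
  have h1 : HasDerivAt (fun y : ℝ => y^2+δ^2) (2*y) y := by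
    simpa using (hasDerivAt_pow 2 y).add_const (δ^2)
  have h2 := (hasDerivAt_id y).div (h1.sqrt hp.ne') hs.ne'
  refine h2.congr_deriv ?_
  have hq := Real.sq_sqrt hp.le
  simp only [id]
  field_simp
  rw [hq]; ring

lemma phi_contDiff {δ : ℝ} (hδ : 0 < δ) : ContDiff ℝ 1 (fun y : ℝ => y / √(y^2+δ^2)) := by
  have hp : ∀ y : ℝ, y^2+δ^2 ≠ 0 := fun y => by positivity
  have hs : ∀ y : ℝ, √(y^2+δ^2) ≠ 0 := fun y => (Real.sqrt_pos.2 (by positivity)).ne'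
  refine contDiff_id.div (ContDiff.sqrt (by fun_prop) hp) hs

lemma contraction (α β : ℝ) (hα : -1 < α) (hβ : -1 < β) [IsFiniteMeasure (jacobiMeasure α β)]
    {G : ℝ → ℝ} (hG : ContDiff ℝ 2 G) {T : ℝ} (hT : 0 ≤ T) :
    T * ∫ θ, |G (Real.cos θ)| ∂(jacobiMeasure α β) ≤
      ∫ θ, |-EE α β (deriv G) (Real.cos θ) + T * G (Real.cos θ)| ∂(jacobiMeasure α β) := by
  have hG' : ContDiff ℝ 1 (deriv G) := by
    have : ContDiff ℝ (1+1) G := by simpa [one_add_one_eq_two] using hG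
    exact (contDiff_succ_iff_deriv.1 this).2.2
  have cG := hG.continuous
  have cE := EE_cont α β hG'
  have main : ∀ δ : ℝ, 0 < δ → 
      T * ∫ θ, |G (Real.cos θ)| ∂(jacobiMeasure α β) ≤
      ∫ θ, |-EE α β (deriv G) (Real.cos θ) + T * G (Real.cos θ)| ∂(jacobiMeasure α β) +
        δ * (T * (jacobiMeasure α β).real univ) := by
    intro δ hδ
    set φ : ℝ → ℝ := fun y : ℝ => y / √(y^2+δ^2) with hφ
    have hH : ContDiff ℝ 1 (fun x => φ (G x)) := (phi_contDiff hδ).comp (hG.of_le (by norm_num))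
    have cH := hH.continuous
    have hi := ibp α β hα hβ hG hH
    have hd : ∀ x, deriv (fun x => φ (G x)) x = δ^2 / (√(G x^2+δ^2))^3 * deriv G x := by
      intro x
      exact ((phi_hasDerivAt hδ (G x)).comp x (hG.differentiable (by simp) x).hasDerivAt).deriv
    have hnn : 0 ≤ ∫ θ, (1 - Real.cos θ ^2) * (deriv G (Real.cos θ) * 
        deriv (fun x => φ (G x)) (Real.cos θ)) ∂(jacobiMeasure α β) := by
      refine integral_nonneg fun θ => ?_
      simp only [hd, Pi.zero_apply]
      have : 0 ≤ 1 - Real.cos θ^2 := by nlinarith [Real.cos_sq_le_one θ]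
      refine mul_nonneg this ?_
      have e : deriv G (Real.cos θ) * (δ^2 / (√(G (Real.cos θ)^2+δ^2))^3 * deriv G (Real.cos θ)) =
        δ^2 / (√(G (Real.cos θ)^2+δ^2))^3 * (deriv G (Real.cos θ))^2 := by ring
      rw [e]; positivity
    have p1 : ∀ y : ℝ, |φ y| ≤ 1 := by
      intro y
      have hs : 0 < √(y^2+δ^2) := Real.sqrt_pos.2 (by positivity)
      rw [hφ]; simp only
      rw [abs_div, abs_of_pos hs, div_le_one hs]
      exact Real.abs_le_sqrt (by nlinarith)
    have p2 : ∀ y : ℝ, |y| - δ ≤ y * φ y := by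
      intro y
      have hs : 0 < √(y^2+δ^2) := Real.sqrt_pos.2 (by positivity)
      have hq := Real.sq_sqrt (show 0 ≤ y^2+δ^2 by positivity)
      have hle : √(y^2+δ^2) ≤ |y| + δ := by
        rw [Real.sqrt_le_left (by positivity)]
        nlinarith [abs_nonneg y, sq_abs y]
      have e : y * φ y = |y|^2 / √(y^2+δ^2) := by rw [hφ, sq_abs]; ring
      rw [e, le_div_iff₀ hs]
      rcases le_total |y| δ with h | h
      · nlinarith [sq_nonneg |y|]
      · nlinarith
    have i1 : Integrable (fun θ => EE α β (deriv G) (Real.cos θ) * φ (G (Real.cos θ))) (jacobiMeasure α β) :=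
      integrable_cos α β (h := fun x => EE α β (deriv G) x * φ (G x)) (cE.mul cH)
    have i2 : Integrable (fun θ => G (Real.cos θ) * φ (G (Real.cos θ))) (jacobiMeasure α β) :=
      integrable_cos α β (h := fun x => G x * φ (G x)) (cG.mul cH)
    have i1n : Integrable (fun θ => -(EE α β (deriv G) (Real.cos θ) * φ (G (Real.cos θ)))) (jacobiMeasure α β) := i1.neg
    have i3 : Integrable (fun θ => |G (Real.cos θ)|) (jacobiMeasure α β) :=
      integrable_cos α β (h := fun x => |G x|) (by fun_prop)
    have i4 : Integrable (fun θ => |-EE α β (deriv G) (Real.cos θ) + T * G (Real.cos θ)|) (jacobiMeasure α β) :=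
      integrable_cos α β (h := fun x => |-EE α β (deriv G) x + T * G x|) (by fun_prop)
    have s1 : ∫ θ, (|G (Real.cos θ)| - δ) ∂(jacobiMeasure α β) ≤
        ∫ θ, G (Real.cos θ) * φ (G (Real.cos θ)) ∂(jacobiMeasure α β) :=
      integral_mono (i3.sub (integrable_const δ)) i2 (fun θ => p2 _)
    rw [integral_sub i3 (integrable_const δ), integral_const, smul_eq_mul] at s1
    have s2 : ∫ θ, (-(EE α β (deriv G) (Real.cos θ) * φ (G (Real.cos θ))) + 
          T * (G (Real.cos θ) * φ (G (Real.cos θ)))) ∂(jacobiMeasure α β) ≤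
        ∫ θ, |-EE α β (deriv G) (Real.cos θ) + T * G (Real.cos θ)| ∂(jacobiMeasure α β) := by
      refine integral_mono (i1.neg.add (i2.const_mul T)) i4 (fun θ => ?_)
      have e : -(EE α β (deriv G) (Real.cos θ) * φ (G (Real.cos θ))) + 
          T * (G (Real.cos θ) * φ (G (Real.cos θ))) = 
          (-EE α β (deriv G) (Real.cos θ) + T * G (Real.cos θ)) * φ (G (Real.cos θ)) := by ring
      simp only [e]
      refine (le_abs_self _).trans ?_
      rw [abs_mul]
      exact mul_le_of_le_one_right (abs_nonneg _) (p1 _)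
    rw [integral_add i1n (i2.const_mul T), integral_neg, integral_const_mul, hi] at s2
    nlinarith [mul_le_mul_of_nonneg_left s1 hT]
  refine le_of_forall_pos_le_add fun ε hε => ?_
  have hK : 0 ≤ T * (jacobiMeasure α β).real univ := mul_nonneg hT measureReal_nonneg
  refine (main (ε / (T * (jacobiMeasure α β).real univ + 1)) (by positivity)).trans ?_
  gcongr
  rw [div_mul_eq_mul_div, div_le_iff₀ (by positivity)]
  nlinarith

lemma flux_bound' (α β : ℝ) (hα : -1 < α) (hβ : -1 < β) [IsFiniteMeasure (jacobiMeasure α β)]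
    {G : ℝ → ℝ} (hG : ContDiff ℝ 2 G) {T : ℝ} (hT : 0 ≤ T) {θ : ℝ} (hθ : θ ∈ Icc 0 π) :
    |flux α β (deriv G) θ| ≤ 2 * 
      ∫ θ, |-EE α β (deriv G) (Real.cos θ) + T * G (Real.cos θ)| ∂(jacobiMeasure α β) := by
  have hG' : ContDiff ℝ 1 (deriv G) := by
    have : ContDiff ℝ (1+1) G := by simpa [one_add_one_eq_two] using hG
    exact (contDiff_succ_iff_deriv.1 this).2.2
  have cG := hG.continuous
  have cE := EE_cont α β hG'
  have h1 := contraction α β hα hβ hG hT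
  have h2 := flux_bound α β hα hβ hG' hθ
  have i3 : Integrable (fun θ => |G (Real.cos θ)|) (jacobiMeasure α β) :=
    integrable_cos α β (h := fun x => |G x|) (by fun_prop)
  have i4 : Integrable (fun θ => |-EE α β (deriv G) (Real.cos θ) + T * G (Real.cos θ)|) (jacobiMeasure α β) :=
    integrable_cos α β (h := fun x => |-EE α β (deriv G) x + T * G x|) (by fun_prop)
  have i5 : Integrable (fun θ => |EE α β (deriv G) (Real.cos θ)|) (jacobiMeasure α β) :=
    integrable_cos α β (h := fun x => |EE α β (deriv G) x|) (by fun_prop)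
  have h3 := integral_mono i5 (i4.add (i3.const_mul T)) (fun θ => by
    simp only [Pi.add_apply]
    have := abs_sub_abs_le_abs_sub (EE α β (deriv G) (Real.cos θ)) (T * G (Real.cos θ))
    rw [abs_mul, abs_of_nonneg hT, abs_sub_comm] at this
    rw [show -EE α β (deriv G) (Real.cos θ) + T * G (Real.cos θ) = 
      T * G (Real.cos θ) - EE α β (deriv G) (Real.cos θ) by ring]
    linarith)
  rw [integral_add' i4 (i3.const_mul T), integral_const_mul] at h3
  linarith

open Polynomial in
def tk (k j : ℕ) : ℝ[X] := (C (1/2) * (X - C 1))^k * (C (1/2) * (X + C 1))^j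

def Acoef (α β : ℝ) (n k : ℕ) : ℝ :=
  (Real.Gamma ((n:ℝ)+α+1) / (Real.Gamma (α+(k:ℝ)+1) * (Nat.factorial (n-k)))) *
    (Real.Gamma ((n:ℝ)+β+1) / (Real.Gamma ((n:ℝ)+β-(k:ℝ)+1) * (Nat.factorial k)))

open Polynomial in
def JP (α β : ℝ) (n : ℕ) : ℝ[X] := ∑ k ∈ Finset.range (n+1), C (Acoef α β n k) * tk k (n-k)

lemma tk_eval (k j : ℕ) (x : ℝ) : (tk k j).eval x = ((x-1)/2)^k * ((x+1)/2)^j := by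
  simp [tk]; ring

lemma JP_eval (α β : ℝ) (n : ℕ) (x : ℝ) : (JP α β n).eval x = jacobiPoly α β n x := by
  simp only [JP, jacobiPoly, Polynomial.eval_finsetSum, Polynomial.eval_mul, Polynomial.eval_C,
    tk_eval, Acoef]
  refine Finset.sum_congr rfl fun k _ => by ring

def LL (α β x : ℝ) (p : Polynomial ℝ) : ℝ :=
  (1 - x^2) * p.derivative.derivative.eval x + linc α β x * p.derivative.eval x

lemma LL_tk (α β x : ℝ) (k j : ℕ) : LL α β x (tk k j) =
    -(k*(k+α) * (((x-1)/2)^(k-1) * ((x+1)/2)^(j+1)) +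
      (2*k*j+(α+1)*j+(β+1)*k) * (((x-1)/2)^k * ((x+1)/2)^j) +
      j*(j+β) * (((x-1)/2)^(k+1) * ((x+1)/2)^(j-1))) := by
  obtain ⟨a, rfl⟩ : ∃ a, x = 2*a+1 := ⟨(x-1)/2, by ring⟩
  rcases k with _ | _ | k <;> rcases j with _ | _ | j <;>
  simp [LL, linc, tk, Polynomial.derivative_mul, Polynomial.derivative_pow] <;> ring

lemma Acoef_rec (α β : ℝ) (hα : -1 < α) (hβ : -1 < β) (n k : ℕ) (hk : k < n) :
    Acoef α β n (k+1) * ((k+1)*(k+1+α)) = Acoef α β n k * (((n-k:ℕ):ℝ)*((n-k:ℕ)+β)) := by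
  obtain ⟨m, rfl⟩ : ∃ m, n = k+1+m := ⟨n-(k+1), by omega⟩
  have k0 : (0:ℝ) ≤ k := k.cast_nonneg
  have m0 : (0:ℝ) ≤ m := m.cast_nonneg
  have e1 : Real.Gamma (α+((k+1:ℕ):ℝ)+1) = (α+k+1) * Real.Gamma (α+k+1) := by
    rw [← Real.Gamma_add_one (by linarith)]; congr 1; push_cast; ring
  have e2 : Real.Gamma (((k+1+m:ℕ):ℝ)+β-k+1) = (m+β+1) * Real.Gamma (m+β+1) := by
    rw [← Real.Gamma_add_one (by linarith)]; congr 1; push_cast; ring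
  have e3 : Real.Gamma (((k+1+m:ℕ):ℝ)+β-((k+1:ℕ):ℝ)+1) = Real.Gamma (m+β+1) := by
    congr 1; push_cast; ring
  have e4 : k+1+m-k = m+1 := by omega
  have e5 : k+1+m-(k+1) = m := by omega
  have g1 : Real.Gamma (α+k+1) ≠ 0 := (Real.Gamma_pos_of_pos (by linarith)).ne'
  have g2 : Real.Gamma (m+β+1) ≠ 0 := (Real.Gamma_pos_of_pos (by linarith)).ne'
  have g3 : α+k+1 ≠ 0 := by linarith
  have g4 : m+β+1 ≠ 0 := by linarith
  have g5 : (k.factorial : ℝ) ≠ 0 := by positivity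
  have g6 : (m.factorial : ℝ) ≠ 0 := by positivity
  simp only [Acoef, e1, e2, e3, e4, e5, Nat.factorial_succ]
  push_cast
  field_simp
  ring

lemma Acoef_pos (α β : ℝ) (hα : -1 < α) (hβ : -1 < β) (n k : ℕ) (hk : k ≤ n) :
    0 < Acoef α β n k := by
  have k0 : (0:ℝ) ≤ k := k.cast_nonneg
  have n0 : (k:ℝ) ≤ n := by exact_mod_cast hk
  have := Real.Gamma_pos_of_pos (show 0 < (n:ℝ)+α+1 by linarith)
  have := Real.Gamma_pos_of_pos (show 0 < (n:ℝ)+β+1 by linarith)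
  have := Real.Gamma_pos_of_pos (show 0 < α+(k:ℝ)+1 by linarith)
  have := Real.Gamma_pos_of_pos (show 0 < (n:ℝ)+β-(k:ℝ)+1 by linarith)
  unfold Acoef; positivity

def lam (α β : ℝ) (n : ℕ) : ℝ := n * (n + α + β + 1)

lemma LL_JP (α β : ℝ) (hα : -1 < α) (hβ : -1 < β) (n : ℕ) (x : ℝ) :
    LL α β x (JP α β n) = - lam α β n * (JP α β n).eval x := by
  have h0 : LL α β x (JP α β n) = ∑ k ∈ Finset.range (n+1), Acoef α β n k * LL α β x (tk k (n-k)) := by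
    simp only [LL, JP, Polynomial.derivative_sum, Polynomial.eval_finsetSum, Finset.mul_sum,
      Polynomial.derivative_C_mul, Polynomial.eval_mul, Polynomial.eval_C, ← Finset.sum_add_distrib]
    refine Finset.sum_congr rfl fun k _ => by ring
  set a := (x-1)/2
  set b := (x+1)/2
  have h1 : ∑ k ∈ Finset.range (n+1), Acoef α β n k * (k*(k+α) * (a^(k-1) * b^(n-k+1))) =
      ∑ k ∈ Finset.range (n+1), Acoef α β n k * (((n-k:ℕ):ℝ)*((n-k:ℕ)+β)) * (a^k * b^(n-k)) := by
    rw [Finset.sum_range_succ', Finset.sum_range_succ]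
    simp only [Nat.cast_zero, zero_mul, mul_zero, add_zero, Nat.sub_self]
    refine Finset.sum_congr rfl fun k hk => ?_
    have hk := Finset.mem_range.1 hk
    rw [← Acoef_rec α β hα hβ n k hk, show n - (k+1) + 1 = n - k by omega]
    simp only [Nat.add_sub_cancel]; push_cast; ring
  have h2 : ∑ k ∈ Finset.range (n+1), Acoef α β n k * (((n-k:ℕ):ℝ)*((n-k:ℕ)+β) * (a^(k+1) * b^(n-k-1))) =
      ∑ k ∈ Finset.range (n+1), Acoef α β n k * (k*(k+α)) * (a^k * b^(n-k)) := by
    rw [Finset.sum_range_succ, Finset.sum_range_succ']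
    simp only [Nat.cast_zero, zero_mul, mul_zero, add_zero, Nat.sub_self]
    refine Finset.sum_congr rfl fun k hk => ?_
    have hk := Finset.mem_range.1 hk
    have := Acoef_rec α β hα hβ n k hk
    rw [show n - k - 1 = n - (k+1) by omega]
    push_cast
    linear_combination (-(a^(k+1) * b^(n-(k+1)))) * this
  have h3 : LL α β x (JP α β n) = 
     -(∑ k ∈ Finset.range (n+1), Acoef α β n k * (k*(k+α) * (a^(k-1) * b^(n-k+1))) +
     ∑ k ∈ Finset.range (n+1), Acoef α β n k * ((2*k*(n-k:ℕ)+(α+1)*(n-k:ℕ)+(β+1)*k) * (a^k * b^(n-k))) + 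
     ∑ k ∈ Finset.range (n+1), Acoef α β n k * (((n-k:ℕ):ℝ)*((n-k:ℕ)+β) * (a^(k+1) * b^(n-k-1)))) := by
    rw [h0, ← Finset.sum_add_distrib, ← Finset.sum_add_distrib, ← Finset.sum_neg_distrib]
    refine Finset.sum_congr rfl fun k _ => ?_
    rw [LL_tk]; ring
  rw [h3, h1, h2, ← Finset.sum_add_distrib, ← Finset.sum_add_distrib, ← Finset.sum_neg_distrib]
  simp only [JP, Polynomial.eval_finsetSum, Polynomial.eval_mul, Polynomial.eval_C, tk_eval]
  rw [Finset.mul_sum]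
  refine Finset.sum_congr rfl fun k hk => ?_
  have hk := Finset.mem_range.1 hk
  rw [Nat.cast_sub (by omega)]
  unfold lam; ring

lemma tk_natDegree (k j : ℕ) : (tk k j).natDegree ≤ k + j := by
  unfold tk
  refine (Polynomial.natDegree_mul_le).trans (add_le_add ?_ ?_)
  · refine Polynomial.natDegree_pow_le.trans ?_
    refine (Nat.mul_le_mul_left k (m := 1) ?_).trans (by simp)
    exact (Polynomial.natDegree_C_mul_le _ _).trans (by rw [Polynomial.natDegree_X_sub_C])
  · refine Polynomial.natDegree_pow_le.trans ?_
    refine (Nat.mul_le_mul_left j (m := 1) ?_).trans (by simp)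
    exact (Polynomial.natDegree_C_mul_le _ _).trans (by rw [Polynomial.natDegree_X_add_C])

lemma tk_coeff (k j : ℕ) : (tk k j).coeff (k + j) = (1/2)^(k+j) := by
  unfold tk
  have d1 : (Polynomial.C (1/2:ℝ) * (Polynomial.X - Polynomial.C 1)).natDegree ≤ 1 :=
    (Polynomial.natDegree_C_mul_le _ _).trans (by rw [Polynomial.natDegree_X_sub_C])
  have d2 : (Polynomial.C (1/2:ℝ) * (Polynomial.X + Polynomial.C 1)).natDegree ≤ 1 :=
    (Polynomial.natDegree_C_mul_le _ _).trans (by rw [Polynomial.natDegree_X_add_C])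
  have c1 := Polynomial.coeff_pow_of_natDegree_le d1 (m := k)
  have c2 := Polynomial.coeff_pow_of_natDegree_le d2 (m := j)
  rw [mul_one] at c1 c2
  rw [Polynomial.coeff_mul_add_eq_of_natDegree_le
    ((Polynomial.natDegree_pow_le_of_le k d1).trans (by simp))
    ((Polynomial.natDegree_pow_le_of_le j d2).trans (by simp)), c1, c2]
  simp [Polynomial.coeff_one, Polynomial.coeff_X, pow_add]

lemma JP_degree (α β : ℝ) (hα : -1 < α) (hβ : -1 < β) (n : ℕ) : (JP α β n).degree = n := by
  have h1 : (JP α β n).natDegree ≤ n := by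
    refine Polynomial.natDegree_sum_le_of_forall_le _ _ fun k hk => ?_
    have hk := Finset.mem_range.1 hk
    refine (Polynomial.natDegree_C_mul_le _ _).trans ((tk_natDegree k (n-k)).trans (by omega))
  have h2 : (JP α β n).coeff n ≠ 0 := by
    have : (JP α β n).coeff n = ∑ k ∈ Finset.range (n+1), Acoef α β n k * (1/2)^n := by
      rw [JP, Polynomial.finsetSum_coeff]
      refine Finset.sum_congr rfl fun k hk => ?_
      have hk := Finset.mem_range.1 hk
      have := tk_coeff k (n-k)
      rw [show k + (n-k) = n by omega] at this
      rw [Polynomial.coeff_C_mul, this]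
    rw [this]
    refine (Finset.sum_pos (fun k hk => ?_) ⟨0, by simp⟩).ne'
    have hk := Finset.mem_range.1 hk
    have := Acoef_pos α β hα hβ n k (by omega)
    positivity
  exact Polynomial.degree_eq_of_le_of_coeff_ne_zero (Polynomial.degree_le_of_natDegree_le h1) h2

def JSeq (α β : ℝ) (hα : -1 < α) (hβ : -1 < β) : Polynomial.Sequence ℝ where
  elems' := JP α β
  degree_eq' := JP_degree α β hα hβ

lemma JP_span (α β : ℝ) (hα : -1 < α) (hβ : -1 < β) :
    Submodule.span ℝ (Set.range (JP α β)) = ⊤ :=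
  (JSeq α β hα hβ).span (fun i => by
    simp)

def QQ (α β : ℝ) (c : ℕ → ℝ) (n : ℕ) (x : ℝ) : ℝ := c n * jacobiPoly α β n x

def QP (α β : ℝ) (c : ℕ → ℝ) (n : ℕ) : Polynomial ℝ := Polynomial.C (c n) * JP α β n

lemma QQ_eq (α β : ℝ) (c : ℕ → ℝ) (n : ℕ) : QQ α β c n = fun x => (QP α β c n).eval x := by
  ext x; simp [QQ, QP, JP_eval]

lemma QQ_contDiff (α β : ℝ) (c : ℕ → ℝ) (n : ℕ) (m : WithTop ℕ∞) : ContDiff ℝ m (QQ α β c n) := by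
  rw [QQ_eq]; simpa using (QP α β c n).contDiff_aeval (𝕜 := ℝ) m

@[fun_prop]
lemma QQ_cont (α β : ℝ) (c : ℕ → ℝ) (n : ℕ) : Continuous (QQ α β c n) :=
  (QQ_contDiff α β c n 0).continuous

lemma deriv_QQ (α β : ℝ) (c : ℕ → ℝ) (n : ℕ) : deriv (QQ α β c n) = 
    fun x => (QP α β c n).derivative.eval x := by
  rw [QQ_eq]; ext x; exact Polynomial.deriv _

lemma EE_QQ (α β : ℝ) (hα : -1 < α) (hβ : -1 < β) (c : ℕ → ℝ) (n : ℕ) (x : ℝ) :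
    EE α β (deriv (QQ α β c n)) x = - lam α β n * QQ α β c n x := by
  have := LL_JP α β hα hβ n x
  rw [EE, deriv_QQ, Polynomial.deriv, QQ_eq]
  simp only [QP, Polynomial.derivative_C_mul, Polynomial.eval_mul, Polynomial.eval_C]
  unfold LL at this
  linear_combination c n * this

lemma fin_meas (α β : ℝ) (hα : -1 < α) (hβ : -1 < β) (c : ℕ → ℝ) (hc : JacobiNormalized α β c) :
    IsFiniteMeasure (jacobiMeasure α β) := by
  have h := hc.2 0
  have e : ∀ θ, nJacobi α β c 0 θ = c 0 := by
    intro θ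
    have g1 := (Real.Gamma_pos_of_pos (show 0 < α+1 by linarith)).ne'
    have g2 := (Real.Gamma_pos_of_pos (show 0 < β+1 by linarith)).ne'
    simp [nJacobi, jacobiPoly, g1, g2]
  simp only [e, integral_const, smul_eq_mul] at h
  have h1 : (jacobiMeasure α β).real univ ≠ 0 := by
    intro h0; rw [h0] at h; simp at h
  constructor
  rw [lt_top_iff_ne_top]
  intro h0
  exact h1 (by simp [Measure.real, h0])

lemma lam_nonneg (α β : ℝ) (hα : -1 < α) (hβ : -1 < β) (n : ℕ) : 0 ≤ lam α β n := by
  unfold lam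
  rcases n with _ | n
  · simp
  · have : (0:ℝ) ≤ n := n.cast_nonneg
    push_cast
    exact mul_nonneg (by linarith) (by linarith)

section
variable (α β : ℝ) (hα : -1 < α) (hβ : -1 < β) (c : ℕ → ℝ) 

def ip (F : ℝ → ℝ) (n : ℕ) : ℝ := ∫ θ, F (Real.cos θ) * QQ α β c n (Real.cos θ) ∂(jacobiMeasure α β)

def SN (F : ℝ → ℝ) (N : ℕ) (x : ℝ) : ℝ := ∑ n ∈ Finset.range N, ip α β c F n * QQ α β c n x

end

lemma ip_lam (α β : ℝ) (hα : -1 < α) (hβ : -1 < β) [IsFiniteMeasure (jacobiMeasure α β)]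
    (c : ℕ → ℝ) {F : ℝ → ℝ} (hF : ContDiff ℝ 2 F) (n : ℕ) :
    lam α β n * ip α β c F n = 
      - ∫ θ, EE α β (deriv F) (Real.cos θ) * QQ α β c n (Real.cos θ) ∂(jacobiMeasure α β) := by
  have h1 := ibp α β hα hβ hF (QQ_contDiff α β c n 1)
  have h2 := ibp α β hα hβ (QQ_contDiff α β c n 2) (hF.of_le (by norm_num))
  simp only [EE_QQ α β hα hβ] at h2
  have e : ∀ θ, -lam α β n * QQ α β c n (Real.cos θ) * F (Real.cos θ) = 
    (-lam α β n) * (F (Real.cos θ) * QQ α β c n (Real.cos θ)) := fun θ => by ring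
  simp only [e, integral_const_mul, mul_comm (deriv (QQ α β c n) _)] at h2
  rw [h1]
  unfold ip
  linarith

lemma lam_inj (α β : ℝ) (hα : -1 < α) (hβ : -1 < β) {m n : ℕ} (h : m ≠ n) : lam α β m ≠ lam α β n := by
  intro h0
  unfold lam at h0
  have h1 : ((m:ℝ) - n) * (m + n + α + β + 1) = 0 := by linear_combination h0
  rcases mul_eq_zero.1 h1 with h2 | h2
  · exact h (by exact_mod_cast sub_eq_zero.1 h2)
  · have : (1:ℝ) ≤ m + n := by exact_mod_cast (show 1 ≤ m + n by omega)
    linarith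

lemma orthon (α β : ℝ) (hα : -1 < α) (hβ : -1 < β) [IsFiniteMeasure (jacobiMeasure α β)]
    (c : ℕ → ℝ) (hc : JacobiNormalized α β c) (m n : ℕ) :
    ip α β c (QQ α β c m) n = if m = n then 1 else 0 := by
  split_ifs with h
  · subst h
    have := hc.2 m
    rw [← this]
    refine integral_congr_ae (Eventually.of_forall fun θ => ?_)
    simp [nJacobi, QQ]; ring
  · have h1 := ip_lam α β hα hβ c (QQ_contDiff α β c m 2) n
    simp only [EE_QQ α β hα hβ, mul_assoc, integral_const_mul] at h1
    have h2 := lam_inj α β hα hβ h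
    unfold ip at h1 ⊢
    have : (lam α β m - lam α β n) * ∫ θ, QQ α β c m (Real.cos θ) * QQ α β c n (Real.cos θ) ∂(jacobiMeasure α β) = 0 := by
      linear_combination -h1
    exact (mul_eq_zero.1 this).resolve_left (sub_ne_zero.2 h2)

lemma QQ_L1 (α β : ℝ) [IsFiniteMeasure (jacobiMeasure α β)]
    (c : ℕ → ℝ) (hc : JacobiNormalized α β c) (n : ℕ) {h : ℝ → ℝ} (hh : Continuous h) :
    |∫ θ, h (Real.cos θ) * QQ α β c n (Real.cos θ) ∂(jacobiMeasure α β)| ≤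
    1 + ∫ θ, h (Real.cos θ)^2 ∂(jacobiMeasure α β) := by
  refine abs_integral_le_integral_abs.trans ?_
  have h1 : ∫ θ, QQ α β c n (Real.cos θ)^2 ∂(jacobiMeasure α β) = 1 := hc.2 n
  have i1 := integrable_cos α β (h := fun x => QQ α β c n x^2) (by fun_prop)
  have i2 := integrable_cos α β (h := fun x => h x^2) (by fun_prop)
  have i3 := integrable_cos α β (h := fun x => |h x * QQ α β c n x|) (by fun_prop)
  rw [← h1, ← integral_add i1 i2]
  refine integral_mono i3 (i1.add i2) fun θ => ?_
  simp only [Pi.add_apply]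
  rw [abs_le]
  constructor <;> nlinarith [sq_nonneg (h (Real.cos θ) + QQ α β c n (Real.cos θ)),
    sq_nonneg (h (Real.cos θ) - QQ α β c n (Real.cos θ)), sq_nonneg (h (Real.cos θ)), sq_nonneg (QQ α β c n (Real.cos θ))]

lemma ip_decay (α β : ℝ) (hα : -1 < α) (hβ : -1 < β) [IsFiniteMeasure (jacobiMeasure α β)]
    (c : ℕ → ℝ) (hc : JacobiNormalized α β c) {F : ℝ → ℝ} (hF : ContDiff ℝ 2 F) :
    ∃ K : ℝ, 0 ≤ K ∧ ∀ n, lam α β n * |ip α β c F n| ≤ K := by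
  have hF' : ContDiff ℝ 1 (deriv F) := by
    have : ContDiff ℝ (1+1) F := by simpa [one_add_one_eq_two] using hF
    exact (contDiff_succ_iff_deriv.1 this).2.2
  refine ⟨1 + ∫ θ, EE α β (deriv F) (Real.cos θ)^2 ∂(jacobiMeasure α β), ?_, fun n => ?_⟩
  · have : 0 ≤ ∫ θ, EE α β (deriv F) (Real.cos θ)^2 ∂(jacobiMeasure α β) :=
      integral_nonneg fun θ => sq_nonneg _
    linarith
  · have h1 := ip_lam α β hα hβ c hF n
    have h2 := QQ_L1 α β c hc n (EE_cont α β hF')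
    rw [← abs_of_nonneg (lam_nonneg α β hα hβ n), ← abs_mul, h1, abs_neg]
    exact h2

lemma QQ_pt (α β : ℝ) (hα : -1 < α) (hβ : -1 < β) [IsFiniteMeasure (jacobiMeasure α β)]
    (c : ℕ → ℝ) (hc : JacobiNormalized α β c) :
    ∃ K : ℝ, 0 ≤ K ∧ ∀ n, ∀ θ ∈ Icc 0 π, |flux α β (QQ α β c n) θ| ≤ K + lam α β n := by
  set L := |β - α| + |α + β + 2| with hL
  have hL0 : 0 ≤ L := by positivity
  have hM0 : 0 ≤ (jacobiMeasure α β).real univ := measureReal_nonneg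
  refine ⟨(1 + L) * (jacobiMeasure α β).real univ + L, by positivity, fun n θ hθ => ?_⟩
  refine (flux_bound α β hα hβ (QQ_contDiff α β c n 1) hθ).trans ?_
  have cd : Continuous (deriv (QQ α β c n)) := (QQ_contDiff α β c n 1).continuous_deriv (by simp)
  have cE := EE_cont α β (QQ_contDiff α β c n 1)
  have h1 : ∫ θ, QQ α β c n (Real.cos θ)^2 ∂(jacobiMeasure α β) = 1 := hc.2 n
  have h2 := ibp α β hα hβ (QQ_contDiff α β c n 2) (QQ_contDiff α β c n 1)
  simp only [EE_QQ α β hα hβ, mul_assoc, integral_const_mul] at h2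
  simp only [← sq] at h2
  rw [h1] at h2
  have i0 := integrable_cos α β (h := fun x => |EE α β (QQ α β c n) x|) (by fun_prop)
  have i1 := integrable_cos α β (h := fun x => L * QQ α β c n x^2) (by fun_prop)
  have i2 := integrable_cos α β (h := fun x => (1 - x^2) * deriv (QQ α β c n) x^2) (by fun_prop)
  have i3 : Integrable (fun _ => 1 + L) (jacobiMeasure α β) := integrable_const _
  have i4 : Integrable (fun θ => (1+L) + L * QQ α β c n (Real.cos θ)^2) (jacobiMeasure α β) := i3.add i1
  have hm := integral_mono i0 (i4.add i2) fun θ => by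
    simp only [Pi.add_apply, EE, linc]
    have hx1 := Real.neg_one_le_cos θ
    have hx2 := Real.cos_le_one θ
    generalize Real.cos θ = x at *
    generalize deriv (QQ α β c n) x = d
    generalize QQ α β c n x = q
    have hl : |β - α - (α+β+2)*x| ≤ L := by
      refine (abs_sub _ _).trans ?_
      rw [abs_mul, hL]
      gcongr
      exact mul_le_of_le_one_right (abs_nonneg _) (abs_le.2 ⟨hx1, hx2⟩)
    have hx : 0 ≤ 1 - x^2 := by nlinarith
    have hd : |d| ≤ 1 + d^2 := by rw [abs_le]; constructor <;> nlinarith [sq_nonneg (d-1), sq_nonneg (d+1)]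
    have hq : |q| ≤ 1 + q^2 := by rw [abs_le]; constructor <;> nlinarith [sq_nonneg (q-1), sq_nonneg (q+1)]
    calc |(1-x^2)*d + (β - α - (α+β+2)*x)*q| ≤ |(1-x^2)*d| + |(β - α - (α+β+2)*x)*q| := abs_add_le _ _
      _ = (1-x^2)*|d| + |β - α - (α+β+2)*x| * |q| := by rw [abs_mul, abs_mul, abs_of_nonneg hx]
      _ ≤ (1-x^2)*(1+d^2) + L * (1+q^2) := by gcongr
      _ ≤ 1 + L + L * q^2 + (1-x^2)*d^2 := by nlinarith
  rw [integral_add' i4 i2, integral_add i3 i1, integral_const_mul, h1, integral_const, smul_eq_mul] at hm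
  linarith

lemma complete (α β : ℝ) (hα : -1 < α) (hβ : -1 < β) [IsFiniteMeasure (jacobiMeasure α β)]
    (c : ℕ → ℝ) (hc : JacobiNormalized α β c) {F : ℝ → ℝ} (hF : Continuous F) :
    Tendsto (fun N => ∫ θ, |F (Real.cos θ) - SN α β c F N (Real.cos θ)| ∂(jacobiMeasure α β))
      atTop (nhds 0) := by
  set μ := jacobiMeasure α β with hμ
  have hM0 : 0 ≤ μ.real univ := measureReal_nonneg
  have main : ∀ ε > 0, ∃ N0, ∀ N ≥ N0, ∫ θ, |F (Real.cos θ) - SN α β c F N (Real.cos θ)| ∂μ ≤ ε * μ.real univ := by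
    intro ε hε
    obtain ⟨p, hp⟩ := exists_polynomial_near_of_continuousOn (-1) 1 F hF.continuousOn ε hε
    have hspan : p ∈ Submodule.span ℝ (Set.range (QP α β c)) := by
      have h1 : Submodule.span ℝ (Set.range (JP α β)) ≤ Submodule.span ℝ (Set.range (QP α β c)) := by
        rw [Submodule.span_le]
        rintro _ ⟨n, rfl⟩
        have : JP α β n = (c n)⁻¹ • QP α β c n := by
          rw [QP, ← Polynomial.smul_eq_C_mul, smul_smul, inv_mul_cancel₀ (hc.1 n).ne', one_smul]
        rw [this]
        exact Submodule.smul_mem _ _ (Submodule.subset_span ⟨n, rfl⟩)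
      apply h1
      rw [JP_span α β hα hβ]; trivial
    obtain ⟨l, hl⟩ := (Finsupp.mem_span_range_iff_exists_finsupp).1 hspan
    refine ⟨l.support.sup id + 1, fun N hN => ?_⟩
    have hpN : ∀ x, p.eval x = ∑ n ∈ Finset.range N, l n * QQ α β c n x := by
      intro x
      have : p = ∑ n ∈ Finset.range N, l n • QP α β c n := by
        rw [← hl, Finsupp.sum_of_support_subset]
        · intro n hn
          have := Finset.le_sup (f := id) hn
          simp only [id] at this
          exact Finset.mem_range.2 (by omega)
        · simp
      rw [this, Polynomial.eval_finsetSum]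
      simp [QQ_eq]
    have cS : Continuous (SN α β c F N) := by unfold SN; fun_prop
    set h : ℝ → ℝ := fun x => F x - SN α β c F N x with hh
    have ch : Continuous h := by fun_prop
    have cp : Continuous (fun x => p.eval x) := p.continuous
    have hort : ∀ n ∈ Finset.range N, ∫ θ, h (Real.cos θ) * QQ α β c n (Real.cos θ) ∂μ = 0 := by
      intro n hn
      have i1 := integrable_cos α β (h := fun x => F x * QQ α β c n x) (by fun_prop)
      have i2 := integrable_cos α β (h := fun x => SN α β c F N x * QQ α β c n x) (by fun_prop)
      have e : ∫ θ, SN α β c F N (Real.cos θ) * QQ α β c n (Real.cos θ) ∂μ = ip α β c F n := by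
        simp only [SN, Finset.sum_mul, mul_assoc]
        rw [integral_finsetSum]
        · simp only [integral_const_mul]
          have : ∀ m, ∫ θ, QQ α β c m (Real.cos θ) * QQ α β c n (Real.cos θ) ∂μ = if m = n then 1 else 0 :=
            fun m => orthon α β hα hβ c hc m n
          simp only [this, mul_ite, mul_one, mul_zero]
          rw [Finset.sum_ite_eq' (Finset.range N) n, if_pos hn]
        · intro m _
          exact integrable_cos α β (h := fun x => ip α β c F m * (QQ α β c m x * QQ α β c n x)) (by fun_prop)
      simp only [hh, sub_mul]
      rw [integral_sub i1 i2, e]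
      simp [ip, hμ]
    have hd : ∫ θ, h (Real.cos θ) * (SN α β c F N (Real.cos θ) - p.eval (Real.cos θ)) ∂μ = 0 := by
      have e : ∀ θ, h (Real.cos θ) * (SN α β c F N (Real.cos θ) - p.eval (Real.cos θ)) =
          ∑ n ∈ Finset.range N, (ip α β c F n - l n) * (h (Real.cos θ) * QQ α β c n (Real.cos θ)) := by
        intro θ
        rw [hpN, SN, ← Finset.sum_sub_distrib, Finset.mul_sum]
        exact Finset.sum_congr rfl fun n _ => by ring
      simp only [e]
      rw [integral_finsetSum]
      · refine Finset.sum_eq_zero fun n hn => ?_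
        rw [integral_const_mul, hort n hn, mul_zero]
      · intro n _
        exact integrable_cos α β (h := fun x => (ip α β c F n - l n) * (h x * QQ α β c n x)) (by fun_prop)
    have i1 := integrable_cos α β (h := fun x => h x ^2) (by fun_prop)
    have i2 := integrable_cos α β (h := fun x => h x * (SN α β c F N x - p.eval x)) (by fun_prop)
    have i3 := integrable_cos α β (h := fun x => |h x|) (by fun_prop)
    have s1 : ∫ θ, (h (Real.cos θ)^2 + 2 * (h (Real.cos θ) * (SN α β c F N (Real.cos θ) - p.eval (Real.cos θ)))) ∂μ
        ≤ ∫ θ, ε^2 ∂μ := by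
      refine integral_mono (i1.add (i2.const_mul 2)) (integrable_const _) fun θ => ?_
      have hb := hp (Real.cos θ) ⟨Real.neg_one_le_cos θ, Real.cos_le_one θ⟩
      have hb2 : (p.eval (Real.cos θ) - F (Real.cos θ))^2 ≤ ε^2 := by
        rw [← sq_abs]; exact pow_le_pow_left₀ (abs_nonneg _) hb.le 2
      simp only [hh]
      nlinarith [sq_nonneg (SN α β c F N (Real.cos θ) - p.eval (Real.cos θ))]
    rw [integral_add i1 (i2.const_mul 2), integral_const_mul, hd, integral_const, smul_eq_mul] at s1
    have s2 : ∫ θ, |h (Real.cos θ)| ∂μ ≤ ∫ θ, (ε/2 + (1/(2*ε)) * h (Real.cos θ)^2) ∂μ := by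
      refine integral_mono i3 ((integrable_const _).add (i1.const_mul _)) fun θ => ?_
      simp only
      rw [← sq_abs]
      have : ε/2 + (1/(2*ε)) * |h (Real.cos θ)|^2 - |h (Real.cos θ)| = (1/(2*ε)) * (|h (Real.cos θ)| - ε)^2 := by
        field_simp; ring
      have : 0 ≤ (1/(2*ε)) * (|h (Real.cos θ)| - ε)^2 := by positivity
      linarith
    rw [integral_add (integrable_const _) (i1.const_mul _), integral_const_mul, integral_const, smul_eq_mul] at s2
    refine s2.trans ?_
    have : 1/(2*ε) * ∫ θ, h (Real.cos θ)^2 ∂μ ≤ 1/(2*ε) * (μ.real univ * ε^2) := by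
      gcongr; linarith
    have e2 : 1/(2*ε) * (μ.real univ * ε^2) = ε/2 * μ.real univ := by field_simp
    linarith
  rw [Metric.tendsto_atTop]
  intro ε hε
  obtain ⟨N0, hN0⟩ := main (ε / (μ.real univ + 1)) (by positivity)
  refine ⟨N0, fun N hN => ?_⟩
  rw [Real.dist_eq, sub_zero, abs_of_nonneg (integral_nonneg fun θ => abs_nonneg _)]
  refine (hN0 N hN).trans_lt ?_
  rw [div_mul_eq_mul_div, div_lt_iff₀ (by positivity)]
  nlinarith

def ac (α β : ℝ) (c : ℕ → ℝ) (F : ℝ → ℝ) (n : ℕ) : ℝ :=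
  if (n:ℝ) + jacobiTau α β = 0 then 0 else |(n:ℝ) + jacobiTau α β| ^ (-(2:ℝ)) * ip α β c F n

def GN (α β : ℝ) (c : ℕ → ℝ) (F : ℝ → ℝ) (N : ℕ) (x : ℝ) : ℝ :=
  ∑ n ∈ Finset.range N, ac α β c F n * QQ α β c n x

def e0 (α β : ℝ) (c : ℕ → ℝ) (F : ℝ → ℝ) (x : ℝ) : ℝ :=
  if jacobiTau α β = 0 then ip α β c F 0 * QQ α β c 0 x else 0

lemma inner_eq (α β : ℝ) (c : ℕ → ℝ) {f F : ℝ → ℝ} (hf : ∀ θ ∈ Ioo 0 π, f θ = F (Real.cos θ)) (n : ℕ) :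
    jacobiInner α β f (nJacobi α β c n) = ip α β c F n := by
  rw [jacobiInner, ip, integral_jm, integral_jm]
  refine setIntegral_congr_fun measurableSet_Ioo fun θ hθ => ?_
  simp only [hf θ hθ]; rfl

lemma invOp_eq (α β : ℝ) (c : ℕ → ℝ) {f F : ℝ → ℝ} (hf : ∀ θ ∈ Ioo 0 π, f θ = F (Real.cos θ)) (θ : ℝ) :
    jacobiInvOp α β c f θ = ∑' n, ac α β c F n * QQ α β c n (Real.cos θ) := by
  unfold jacobiInvOp
  congr 1
  ext n
  rw [inner_eq α β c hf, ac]
  split_ifs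
  · simp
  · rfl

lemma tau_gt (α β : ℝ) (hα : -1 < α) (hβ : -1 < β) : -(1/2) < jacobiTau α β := by
  unfold jacobiTau; linarith

lemma summ (α β : ℝ) (hα : -1 < α) (hβ : -1 < β) [IsFiniteMeasure (jacobiMeasure α β)]
    (c : ℕ → ℝ) (hc : JacobiNormalized α β c) {F : ℝ → ℝ} (hF : ContDiff ℝ 2 F) {θ : ℝ} (hθ : θ ∈ Ioo 0 π) :
    Summable fun n => ac α β c F n * QQ α β c n (Real.cos θ) := by
  obtain ⟨K1, hK1, h1⟩ := ip_decay α β hα hβ c hc hF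
  obtain ⟨K2, hK2, h2⟩ := QQ_pt α β hα hβ c hc
  set ρ := (Real.sin (θ/2)) ^ (2*α+2) * (Real.cos (θ/2)) ^ (2*β+2) with hρ
  have hρ0 : 0 < ρ :=
    mul_pos (Real.rpow_pos_of_pos (sin_half_pos hθ) _) (Real.rpow_pos_of_pos (cos_half_pos hθ) _)
  have ht := tau_gt α β hα hβ
  have hsum : Summable fun n : ℕ => (4 * K1 * (K2 + 1) / ρ) * (1 / (n:ℝ)^2) :=
    (Real.summable_one_div_nat_pow.2 (by norm_num)).mul_left _
  refine Summable.of_norm_bounded_eventually_nat hsum ?_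
  filter_upwards [eventually_ge_atTop 2] with n hn
  have hn' : (2:ℝ) ≤ n := by exact_mod_cast hn
  have hl : 1 ≤ lam α β n := by unfold lam; nlinarith
  have hp : 0 < (n:ℝ) + jacobiTau α β := by linarith
  rw [ac, if_neg hp.ne', Real.norm_eq_abs, abs_mul, abs_mul]
  have b1 : |(|(n:ℝ) + jacobiTau α β| ^ (-(2:ℝ)))| ≤ 4 / (n:ℝ)^2 := by
    rw [abs_of_pos hp, abs_of_nonneg (by positivity), Real.rpow_neg hp.le, ← one_div, Real.rpow_two,
      div_le_div_iff₀ (by positivity) (by positivity)]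
    nlinarith
  have b2 : |ip α β c F n| * |QQ α β c n (Real.cos θ)| ≤ K1 * (K2+1) / ρ := by
    have q := h2 n θ ⟨hθ.1.le, hθ.2.le⟩
    rw [flux, abs_mul, abs_mul, ← hρ, abs_of_pos hρ0] at q
    norm_num at q
    have q1 : ρ * |QQ α β c n (Real.cos θ)| ≤ (K2+1) * lam α β n := by
      nlinarith [mul_nonneg hρ0.le (abs_nonneg (QQ α β c n (Real.cos θ)))]
    rw [le_div_iff₀ hρ0]
    calc |ip α β c F n| * |QQ α β c n (Real.cos θ)| * ρ = |ip α β c F n| * (ρ * |QQ α β c n (Real.cos θ)|) := by ring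
      _ ≤ |ip α β c F n| * ((K2+1) * lam α β n) := by gcongr
      _ = (lam α β n * |ip α β c F n|) * (K2+1) := by ring
      _ ≤ K1 * (K2+1) := by gcongr; exact h1 n
  calc _ = |(|(n:ℝ) + jacobiTau α β| ^ (-(2:ℝ)))| * (|ip α β c F n| * |QQ α β c n (Real.cos θ)|) := by ring
    _ ≤ 4 / (n:ℝ)^2 * (K1 * (K2+1) / ρ) := by gcongr
    _ = _ := by ring

lemma EE_poly (α β : ℝ) (p : Polynomial ℝ) (x : ℝ) : EE α β (deriv (fun x => p.eval x)) x = LL α β x p := by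
  have : deriv (fun x => p.eval x) = fun x => p.derivative.eval x := by
    ext x; exact Polynomial.deriv _
  rw [EE, this, Polynomial.deriv]; rfl

lemma GN_poly (α β : ℝ) (c : ℕ → ℝ) (F : ℝ → ℝ) (N : ℕ) : GN α β c F N = 
    fun x => (∑ n ∈ Finset.range N, Polynomial.C (ac α β c F n) * QP α β c n).eval x := by
  ext x
  simp [GN, QQ_eq, Polynomial.eval_finsetSum]

lemma GN_contDiff (α β : ℝ) (c : ℕ → ℝ) (F : ℝ → ℝ) (N : ℕ) : ContDiff ℝ 2 (GN α β c F N) := by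
  unfold GN
  exact ContDiff.sum fun n _ => contDiff_const.mul (QQ_contDiff α β c n 2)

lemma GN_EE (α β : ℝ) (hα : -1 < α) (hβ : -1 < β) (c : ℕ → ℝ) (F : ℝ → ℝ) (N : ℕ) (x : ℝ) :
    -EE α β (deriv (GN α β c F (N+1))) x + jacobiTau α β^2 * GN α β c F (N+1) x =
      SN α β c F (N+1) x - e0 α β c F x := by
  have ht := tau_gt α β hα hβ
  have h1 : EE α β (deriv (GN α β c F (N+1))) x = 
      ∑ n ∈ Finset.range (N+1), ac α β c F n * (-lam α β n * QQ α β c n x) := by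
    rw [GN_poly, EE_poly]
    simp only [← EE_QQ α β hα hβ]
    simp only [QQ_eq, EE_poly]
    simp only [LL, Polynomial.derivative_sum, Polynomial.eval_finsetSum, Finset.mul_sum,
      Polynomial.derivative_C_mul, Polynomial.eval_mul, Polynomial.eval_C, ← Finset.sum_add_distrib]
    refine Finset.sum_congr rfl fun k _ => by ring
  have h2 : ∀ n : ℕ, lam α β n + jacobiTau α β^2 = ((n:ℝ) + jacobiTau α β)^2 := by
    intro n; unfold lam jacobiTau; ring
  have h3 : -EE α β (deriv (GN α β c F (N+1))) x + jacobiTau α β^2 * GN α β c F (N+1) x =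
      ∑ n ∈ Finset.range (N+1), ac α β c F n * (((n:ℝ) + jacobiTau α β)^2 * QQ α β c n x) := by
    rw [h1, GN, Finset.mul_sum, ← Finset.sum_neg_distrib, ← Finset.sum_add_distrib]
    refine Finset.sum_congr rfl fun n _ => ?_
    rw [← h2]; ring
  have h4 : ∀ n : ℕ, (n:ℝ) + jacobiTau α β ≠ 0 → 
      ac α β c F n * (((n:ℝ) + jacobiTau α β)^2 * QQ α β c n x) = ip α β c F n * QQ α β c n x := by
    intro n hn
    rw [ac, if_neg hn, Real.rpow_neg (abs_nonneg _), Real.rpow_two, sq_abs]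
    field_simp
  rw [h3, SN, Finset.sum_range_succ', Finset.sum_range_succ']
  have h5 : ∀ n ∈ Finset.range N, ac α β c F (n+1) * ((((n+1:ℕ):ℝ) + jacobiTau α β)^2 * QQ α β c (n+1) x) = 
      ip α β c F (n+1) * QQ α β c (n+1) x := by
    intro n _
    refine h4 (n+1) ?_
    have : (0:ℝ) ≤ n := n.cast_nonneg
    push_cast; linarith
  rw [Finset.sum_congr rfl h5, add_sub_assoc]
  congr 1
  unfold e0
  split_ifs with h0
  · simp [h0]
  · rw [h4 0 (by simpa using h0)]; simp

lemma EE_sub (α β : ℝ) {G H : ℝ → ℝ} (hG : ContDiff ℝ 2 G) (hH : ContDiff ℝ 2 H) (x : ℝ) :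
    EE α β (deriv (fun x => G x - H x)) x = EE α β (deriv G) x - EE α β (deriv H) x := by
  have d1 : ∀ {G : ℝ → ℝ}, ContDiff ℝ 2 G → ContDiff ℝ 1 (deriv G) := by
    intro G hG
    have : ContDiff ℝ (1+1) G := by simpa [one_add_one_eq_two] using hG
    exact (contDiff_succ_iff_deriv.1 this).2.2
  have e1 : deriv (fun x => G x - H x) = fun x => deriv G x - deriv H x := by
    ext x
    exact deriv_fun_sub (hG.differentiable (by simp) x) (hH.differentiable (by simp) x)
  rw [EE, e1, deriv_fun_sub ((d1 hG).differentiable (by simp) x) ((d1 hH).differentiable (by simp) x)]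
  simp only [EE]; ring

lemma flux_deriv (α β : ℝ) {G : ℝ → ℝ} (hG : ContDiff ℝ 2 G) {θ : ℝ} (hθ : θ ∈ Ioo 0 π) :
    wt α β θ * deriv (fun θ => G (Real.cos θ)) θ = flux α β (deriv G) θ := by
  have h := ((hG.differentiable (by simp) (Real.cos θ)).hasDerivAt.comp θ (Real.hasDerivAt_cos θ)).deriv
  have hs := sin_half_pos hθ
  have hc := cos_half_pos hθ
  have e1 : Real.sin θ = 2 * Real.sin (θ/2) * Real.cos (θ/2) := by
    rw [← Real.sin_two_mul]; congr 1; ring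
  have a1 : Real.sin (θ/2) ^ (2*α+2) = Real.sin (θ/2) ^ (2*α+1) * Real.sin (θ/2) := by
    rw [← Real.rpow_add_one hs.ne']; congr 1; ring
  have a2 : Real.cos (θ/2) ^ (2*β+2) = Real.cos (θ/2) ^ (2*β+1) * Real.cos (θ/2) := by
    rw [← Real.rpow_add_one hc.ne']; congr 1; ring
  have h' : deriv (fun θ => G (Real.cos θ)) θ = deriv G (Real.cos θ) * -Real.sin θ := h
  rw [h', flux, wt, a1, a2, e1]; ring

lemma wt_contAt (α β : ℝ) {θ : ℝ} (hθ : θ ∈ Ioo 0 π) : ContinuousAt (wt α β) θ := by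
  unfold wt
  refine ContinuousAt.mul ?_ ?_
  · exact ContinuousAt.rpow_const (by fun_prop) (Or.inl (sin_half_pos hθ).ne')
  · exact ContinuousAt.rpow_const (by fun_prop) (Or.inl (cos_half_pos hθ).ne')

lemma lipsch (α β : ℝ) (hα : -1 < α) (hβ : -1 < β) [IsFiniteMeasure (jacobiMeasure α β)]
    (c : ℕ → ℝ) (hc : JacobiNormalized α β c) {f F G : ℝ → ℝ} (hF : ContDiff ℝ 2 F) (hG : ContDiff ℝ 2 G)
    (hf : ∀ θ ∈ Ioo 0 π, f θ = F (Real.cos θ)) {θ₀ : ℝ} (hθ : θ₀ ∈ Ioo 0 π) {M : ℝ} (hM : (wt α β θ₀)⁻¹ < M) :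
    ∀ᶠ θ in nhds θ₀, |(jacobiInvOp α β c f θ - G (Real.cos θ)) - (jacobiInvOp α β c f θ₀ - G (Real.cos θ₀))| ≤
      M * (2 * ∫ t, |F (Real.cos t) - e0 α β c F (Real.cos t) - 
        (-EE α β (deriv G) (Real.cos t) + jacobiTau α β^2 * G (Real.cos t))| ∂(jacobiMeasure α β)) * |θ - θ₀| := by
  set A := ∫ t, |F (Real.cos t) - e0 α β c F (Real.cos t) - 
        (-EE α β (deriv G) (Real.cos t) + jacobiTau α β^2 * G (Real.cos t))| ∂(jacobiMeasure α β) with hA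
  have hev : ∀ᶠ θ in nhds θ₀, θ ∈ Ioo 0 π ∧ (wt α β θ)⁻¹ < M := by
    refine Filter.Eventually.and (isOpen_Ioo.mem_nhds hθ) ?_
    exact ((wt_contAt α β hθ).inv₀ (wt_pos α β hθ).ne').eventually (gt_mem_nhds hM)
  obtain ⟨δ, hδ, hball⟩ := Metric.eventually_nhds_iff_ball.1 hev
  have hM0 : 0 < M := (inv_pos.2 (wt_pos α β hθ)).trans hM
  filter_upwards [Metric.ball_mem_nhds θ₀ hδ] with θ hθb
  set r : ℕ → ℝ := fun N => ∫ t, |F (Real.cos t) - SN α β c F N (Real.cos t)| ∂(jacobiMeasure α β) with hr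
  have hlim := complete α β hα hβ c hc hF.continuous
  have cF := hF.continuous
  have cG := hG.continuous
  have cEG : Continuous (EE α β (deriv G)) := by
    have : ContDiff ℝ (1+1) G := by simpa [one_add_one_eq_two] using hG
    exact EE_cont α β (contDiff_succ_iff_deriv.1 this).2.2
  have ce : Continuous (e0 α β c F) := by
    unfold e0; split_ifs <;> fun_prop
  have cS : ∀ N, Continuous (SN α β c F N) := by intro N; unfold SN; fun_prop
  have step : ∀ N, |(GN α β c F (N+1) (Real.cos θ) - G (Real.cos θ)) - 
      (GN α β c F (N+1) (Real.cos θ₀) - G (Real.cos θ₀))| ≤ M * (2 * (A + r (N+1))) * |θ - θ₀| := by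
    intro N
    set V : ℝ → ℝ := fun x => GN α β c F (N+1) x - G x with hV
    have hVc : ContDiff ℝ 2 V := (GN_contDiff α β c F (N+1)).sub hG
    have hdiff : Differentiable ℝ (fun θ => V (Real.cos θ)) :=
      (hVc.differentiable (by simp)).comp Real.differentiable_cos
    have cSN := cS (N+1)
    have hI : ∫ t, |-EE α β (deriv V) (Real.cos t) + jacobiTau α β^2 * V (Real.cos t)| ∂(jacobiMeasure α β) ≤ A + r (N+1) := by
      have i1 := integrable_cos α β (h := fun x => |F x - e0 α β c F x - (-EE α β (deriv G) x + jacobiTau α β^2 * G x)|) (by fun_prop)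
      have i2 := integrable_cos α β (h := fun x => |F x - SN α β c F (N+1) x|) (by fun_prop)
      rw [hA, hr]
      simp only
      rw [← integral_add i1 i2]
      have key : ∀ x, -EE α β (deriv V) x + jacobiTau α β^2 * V x =
          (F x - e0 α β c F x - (-EE α β (deriv G) x + jacobiTau α β^2 * G x)) - (F x - SN α β c F (N+1) x) := by
        intro x
        rw [EE_sub α β (GN_contDiff α β c F (N+1)) hG]
        simp only [hV]
        linear_combination GN_EE α β hα hβ c F N x
      refine integral_mono_of_nonneg (Eventually.of_forall fun _ => abs_nonneg _) (i1.add i2) 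
        (Eventually.of_forall fun t => ?_)
      simp only [key]
      exact abs_sub _ _
    have hd : ∀ t ∈ Metric.ball θ₀ δ, ‖deriv (fun θ => V (Real.cos θ)) t‖ ≤ M * (2 * (A + r (N+1))) := by
      intro t ht
      obtain ⟨ht1, ht2⟩ := hball t ht
      have hw := wt_pos α β ht1
      have h1 := flux_deriv α β hVc ht1
      have h2 := flux_bound' α β hα hβ hVc (sq_nonneg (jacobiTau α β)) ⟨ht1.1.le, ht1.2.le⟩
      rw [← h1, abs_mul, abs_of_pos hw] at h2
      have h3 : |deriv (fun θ => V (Real.cos θ)) t| ≤ (wt α β t)⁻¹ * (2 * (A + r (N+1))) := by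
        rw [inv_mul_eq_div, le_div_iff₀ hw]; linarith
      have h4 : 0 ≤ 2 * (A + r (N+1)) := by
        have := (abs_nonneg (deriv (fun θ => V (Real.cos θ)) t)).trans h3
        exact nonneg_of_mul_nonneg_right this (inv_pos.2 hw)
      exact h3.trans (mul_le_mul_of_nonneg_right ht2.le h4)
    exact Convex.norm_image_sub_le_of_norm_deriv_le (fun t _ => hdiff t) hd (convex_ball θ₀ δ)
      (Metric.mem_ball_self hδ) hθb
  have hθI := (hball θ hθb).1
  have t1 : ∀ {t : ℝ}, t ∈ Ioo 0 π → Tendsto (fun N => GN α β c F (N+1) (Real.cos t)) atTop 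
      (nhds (jacobiInvOp α β c f t)) := by
    intro t ht
    rw [invOp_eq α β c hf]
    exact ((summ α β hα hβ c hc hF ht).hasSum.tendsto_sum_nat).comp (tendsto_add_atTop_nat 1)
  refine le_of_tendsto_of_tendsto' (((t1 hθI).sub_const _).sub ((t1 hθ).sub_const _)).abs ?_ step
  have := hlim.comp (tendsto_add_atTop_nat 1)
  have h5 : Tendsto (fun N => M * (2 * (A + r (N+1))) * |θ - θ₀|) atTop (nhds (M * (2 * (A + 0)) * |θ - θ₀|)) :=
    (((this.const_add A).const_mul 2).const_mul M).mul_const _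
  simpa using h5

lemma e0_L1 (α β : ℝ) [IsFiniteMeasure (jacobiMeasure α β)] (c : ℕ → ℝ) :
    ∃ K : ℝ, 0 ≤ K ∧ ∀ F : ℝ → ℝ, Continuous F →
      ∫ t, |F (Real.cos t) - e0 α β c F (Real.cos t)| ∂(jacobiMeasure α β) ≤
        K * ∫ t, |F (Real.cos t)| ∂(jacobiMeasure α β) := by
  obtain ⟨K, hK⟩ := (isCompact_Icc (a := (-1:ℝ)) (b := 1)).exists_bound_of_continuousOn 
    (QQ_cont α β c 0).continuousOn
  have hK' : ∀ θ, |QQ α β c 0 (Real.cos θ)| ≤ K := fun θ => hK _ ⟨Real.neg_one_le_cos θ, Real.cos_le_one θ⟩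
  have hK0 : 0 ≤ K := (abs_nonneg _).trans (hK' 0)
  have hM0 : 0 ≤ (jacobiMeasure α β).real univ := measureReal_nonneg
  refine ⟨1 + K * K * (jacobiMeasure α β).real univ, by positivity, fun F hF => ?_⟩
  have iF := integrable_cos α β (h := fun x => |F x|) (by fun_prop)
  have h1 : |ip α β c F 0| ≤ K * ∫ t, |F (Real.cos t)| ∂(jacobiMeasure α β) := by
    rw [ip, ← integral_const_mul]
    refine abs_integral_le_integral_abs.trans (integral_mono_of_nonneg
      (Eventually.of_forall fun _ => abs_nonneg _) (iF.const_mul K) (Eventually.of_forall fun t => ?_))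
    simp only [abs_mul]
    rw [mul_comm]
    exact mul_le_mul_of_nonneg_right (hK' t) (abs_nonneg _)
  have h2 : ∀ t, |F (Real.cos t) - e0 α β c F (Real.cos t)| ≤ |F (Real.cos t)| + 
      K * K * ∫ t, |F (Real.cos t)| ∂(jacobiMeasure α β) := by
    intro t
    refine (abs_sub _ _).trans (add_le_add_right ?_ _)
    have h0 : 0 ≤ ∫ t, |F (Real.cos t)| ∂(jacobiMeasure α β) := integral_nonneg fun _ => abs_nonneg _
    unfold e0
    split_ifs
    · rw [abs_mul]
      calc _ ≤ (K * ∫ t, |F (Real.cos t)| ∂(jacobiMeasure α β)) * K :=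
            mul_le_mul h1 (hK' t) (abs_nonneg _) (by positivity)
        _ = _ := by ring
    · rw [abs_zero]; positivity
  calc _ ≤ ∫ t, (|F (Real.cos t)| + K * K * ∫ t, |F (Real.cos t)| ∂(jacobiMeasure α β)) ∂(jacobiMeasure α β) :=
        integral_mono_of_nonneg (Eventually.of_forall fun _ => abs_nonneg _) 
          (iF.add (integrable_const _)) (Eventually.of_forall h2)
    _ = _ := by
        rw [integral_add iF (integrable_const _), integral_const, smul_eq_mul]; ring

lemma arccos_smooth {f : ℝ → ℝ} (hf : IsCcSmooth f) : ContDiff ℝ 2 (fun x => f (Real.arccos x)) := by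
  rw [contDiff_iff_contDiffAt]
  intro x
  by_cases h : Real.arccos x ∈ tsupport f
  · obtain ⟨h1, h2⟩ := hf.2.2 h
    have hx1 : x ≠ -1 := by rintro rfl; simp at h2
    have hx2 : x ≠ 1 := by rintro rfl; simp at h1
    exact ContDiffAt.comp x (contDiff_infty.1 hf.1 2).contDiffAt (Real.contDiffAt_arccos hx1 hx2)
  · have : (fun x => f (Real.arccos x)) =ᶠ[nhds x] fun _ => 0 := by
      have h1 : (tsupport f)ᶜ ∈ nhds (Real.arccos x) := (isClosed_tsupport f).isOpen_compl.mem_nhds h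
      filter_upwards [Real.continuous_arccos.continuousAt.preimage_mem_nhds h1] with y hy
      exact image_eq_zero_of_notMem_tsupport hy
    exact contDiffAt_const.congr_of_eventuallyEq this

lemma deriv_bd (α β : ℝ) (hα : -1 < α) (hβ : -1 < β) [IsFiniteMeasure (jacobiMeasure α β)]
    (c : ℕ → ℝ) (hc : JacobiNormalized α β c) {f F G : ℝ → ℝ} (hF : ContDiff ℝ 2 F) (hG : ContDiff ℝ 2 G)
    (hf : ∀ θ ∈ Ioo 0 π, f θ = F (Real.cos θ)) {θ₀ : ℝ} (hθ : θ₀ ∈ Ioo 0 π) :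
    wt α β θ₀ * |deriv (fun θ => jacobiInvOp α β c f θ - G (Real.cos θ)) θ₀| ≤
      2 * ∫ t, |F (Real.cos t) - e0 α β c F (Real.cos t) - 
        (-EE α β (deriv G) (Real.cos t) + jacobiTau α β^2 * G (Real.cos t))| ∂(jacobiMeasure α β) := by
  set A := ∫ t, |F (Real.cos t) - e0 α β c F (Real.cos t) - 
        (-EE α β (deriv G) (Real.cos t) + jacobiTau α β^2 * G (Real.cos t))| ∂(jacobiMeasure α β) with hA
  have hA0 : 0 ≤ A := integral_nonneg fun _ => abs_nonneg _
  have hw := wt_pos α β hθ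
  have h1 : ∀ M, (wt α β θ₀)⁻¹ < M → 
      |deriv (fun θ => jacobiInvOp α β c f θ - G (Real.cos θ)) θ₀| ≤ M * (2 * A) := by
    intro M hM
    have hM0 : 0 < M := (inv_pos.2 hw).trans hM
    have := lipsch α β hα hβ c hc hF hG hf hθ hM
    exact norm_deriv_le_of_lip' (f := fun θ => jacobiInvOp α β c f θ - G (Real.cos θ)) (mul_nonneg hM0.le (mul_nonneg zero_le_two hA0)) this
  have h2 : |deriv (fun θ => jacobiInvOp α β c f θ - G (Real.cos θ)) θ₀| ≤ (wt α β θ₀)⁻¹ * (2 * A) := by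
    refine ge_of_tendsto (x := nhdsWithin (wt α β θ₀)⁻¹ (Ioi (wt α β θ₀)⁻¹)) 
      (f := fun M => M * (2 * A)) ?_ ?_
    · exact ((continuous_id.mul continuous_const).tendsto _).mono_left nhdsWithin_le_nhds
    · filter_upwards [self_mem_nhdsWithin] with M hM using h1 M hM
  rwa [inv_mul_eq_div, le_div_iff₀ hw, mul_comm] at h2

lemma part1 (α β : ℝ) (hα : -1 < α) (hβ : -1 < β) [IsFiniteMeasure (jacobiMeasure α β)]
    (c : ℕ → ℝ) (hc : JacobiNormalized α β c) :
    ∃ C : ℝ, ∀ f : ℝ → ℝ, IsCcSmooth f →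
      ∫ θ in Set.Ioo (3*π/4) π, |opT1 α β c f θ| ∂(jacobiMeasure α β) ≤
        C * ∫ θ, |f θ| ∂(jacobiMeasure α β) := by
  obtain ⟨K, hK0, hK⟩ := e0_L1 α β c
  have hpi := Real.pi_pos
  refine ⟨2 * K * (π/4), fun f hf => ?_⟩
  set F : ℝ → ℝ := fun x => f (Real.arccos x) with hFd
  have hF : ContDiff ℝ 2 F := arccos_smooth hf
  have hfF : ∀ θ ∈ Ioo 0 π, f θ = F (Real.cos θ) := by
    intro θ hθ
    simp only [hFd]
    rw [Real.arccos_cos hθ.1.le hθ.2.le]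
  have hI : ∫ θ, |f θ| ∂(jacobiMeasure α β) = ∫ t, |F (Real.cos t)| ∂(jacobiMeasure α β) := by
    rw [integral_jm, integral_jm]
    refine setIntegral_congr_fun measurableSet_Ioo fun θ hθ => ?_
    simp only [hfF θ hθ]
  have hsub : Ioo (3*π/4) π ⊆ Ioo 0 π := fun x hx => ⟨by linarith [hx.1], hx.2⟩
  set A := K * ∫ θ, |f θ| ∂(jacobiMeasure α β) with hA
  have hpt : ∀ θ ∈ Ioo (3*π/4) π, wt α β θ * |opT1 α β c f θ| ≤ 2 * A := by
    intro θ hθ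
    have hθ' := hsub hθ
    have h1 := deriv_bd α β hα hβ c hc hF (G := fun _ => 0) contDiff_const hfF hθ'
    have h2 := hK F hF.continuous
    have e1 : ∀ x, EE α β (deriv (fun _ => (0:ℝ))) x = 0 := by intro x; simp [EE]
    simp only [e1, sub_zero, neg_zero, mul_zero, add_zero] at h1
    rw [← hI, ← hA] at h2
    have hcot : |Real.cot (θ/2)| ≤ 1 := by
      have s := sin_half_pos hθ'
      have cc := cos_half_pos hθ'
      rw [Real.cot_eq_cos_div_sin, abs_of_pos (div_pos cc s), div_le_one s]
      have h3 : Real.cos (θ/2) ≤ Real.cos (π/4) := 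
        Real.cos_le_cos_of_nonneg_of_le_pi (by linarith) (by linarith [hθ.2]) (by linarith [hθ.1])
      have h4 : Real.sin (π/4) ≤ Real.sin (θ/2) := 
        Real.sin_le_sin_of_le_of_le_pi_div_two (by linarith) (by linarith [hθ.2]) (by linarith [hθ.1])
      rw [Real.cos_pi_div_four] at h3
      rw [Real.sin_pi_div_four] at h4
      linarith
    have hw := wt_pos α β hθ'
    rw [opT1, abs_mul]
    calc _ = |Real.cot (θ/2)| * (wt α β θ * |deriv (jacobiInvOp α β c f) θ|) := by ring
      _ ≤ 1 * (wt α β θ * |deriv (jacobiInvOp α β c f) θ|) := by gcongr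
      _ ≤ _ := by
        rw [one_mul]
        exact h1.trans (by linarith)
  rw [setIntegral_jm α β _ _ measurableSet_Ioo hsub]
  calc _ ≤ ∫ θ in Ioo (3*π/4) π, 2 * A := by
        refine integral_mono_of_nonneg ?_ (integrableOn_const (by simp)) ?_
        · filter_upwards [ae_restrict_mem measurableSet_Ioo] with θ hθ
          exact mul_nonneg (wt_pos α β (hsub hθ)).le (abs_nonneg _)
        · filter_upwards [ae_restrict_mem measurableSet_Ioo] with θ hθ using hpt θ hθ
    _ = _ := by
        rw [setIntegral_const, smul_eq_mul, Measure.real, Real.volume_Ioo, 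
          ENNReal.toReal_ofReal (by linarith), hA]
        ring

def FF (α β : ℝ) (G : ℝ → ℝ) (x : ℝ) : ℝ := -EE α β (deriv G) x + jacobiTau α β^2 * G x

lemma FF_contDiff (α β : ℝ) {G : ℝ → ℝ} (hG : ContDiff ℝ (⊤:ℕ∞) G) : ContDiff ℝ (⊤:ℕ∞) (FF α β G) := by
  have h1 := (contDiff_infty_iff_deriv.1 hG).2
  have h2 := (contDiff_infty_iff_deriv.1 h1).2
  unfold FF EE linc
  fun_prop

lemma FF_zero (α β : ℝ) {G : ℝ → ℝ} {x : ℝ} (hx : x ∉ tsupport G) : FF α β G x = 0 := by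
  have h0 := image_eq_zero_of_notMem_tsupport hx
  have h1 : G =ᶠ[nhds x] fun _ => 0 := notMem_tsupport_iff_eventuallyEq.1 hx
  have h2 : deriv G =ᶠ[nhds x] fun _ => 0 := by simpa using h1.deriv
  have h3 := h2.deriv.eq_of_nhds
  have h4 := h2.eq_of_nhds
  simp at h3 h4
  simp [FF, EE, h0, h3, h4]

def ff (α β : ℝ) (G : ℝ → ℝ) (θ : ℝ) : ℝ := FF α β G (Real.cos (max 0 (min θ π)))

lemma ff_smooth (α β : ℝ) {G : ℝ → ℝ} (hG : ContDiff ℝ (⊤:ℕ∞) G) (hs : tsupport G ⊆ Ioo (-1) 1) :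
    IsCcSmooth (ff α β G) := by
  have hpi := Real.pi_pos
  set S : Set ℝ := (fun θ : ℝ => Real.cos (max 0 (min θ π))) ⁻¹' tsupport G with hS
  have hk : Continuous (fun θ : ℝ => Real.cos (max 0 (min θ π))) := by fun_prop
  have hSc : IsClosed S := (isClosed_tsupport G).preimage hk
  have hS1 : S ⊆ Ioo 0 π := by
    intro θ hθ
    have h : Real.cos (max 0 (min θ π)) ∈ Ioo (-1:ℝ) 1 := hs hθ
    constructor
    · by_contra h0
      push Not at h0
      rw [min_eq_left (by linarith), max_eq_left h0] at h
      simp at h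
    · by_contra h0
      push Not at h0
      rw [min_eq_right h0, max_eq_right hpi.le] at h
      simp at h
  have hsup : Function.support (ff α β G) ⊆ S := by
    intro θ hθ
    by_contra h
    exact hθ (FF_zero α β h)
  have hts : tsupport (ff α β G) ⊆ S := closure_minimal hsup hSc
  refine ⟨?_, ?_, hts.trans hS1⟩
  · rw [contDiff_iff_contDiffAt]
    intro θ
    by_cases h : θ ∈ S
    · have h1 : ContDiff ℝ (⊤:ℕ∞) (fun θ => FF α β G (Real.cos θ)) := (FF_contDiff α β hG).comp Real.contDiff_cos
      refine h1.contDiffAt.congr_of_eventuallyEq ?_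
      filter_upwards [isOpen_Ioo.mem_nhds (hS1 h)] with t ht
      simp only [ff]
      rw [min_eq_left ht.2.le, max_eq_right ht.1.le]
    · have : ff α β G =ᶠ[nhds θ] fun _ => 0 := by
        filter_upwards [hSc.isOpen_compl.mem_nhds h] with t ht
        exact FF_zero α β ht
      exact contDiffAt_const.congr_of_eventuallyEq this
  · exact isCompact_Icc.of_isClosed_subset (isClosed_tsupport _) ((hts.trans hS1).trans Ioo_subset_Icc_self)

lemma e0_FF (α β : ℝ) (hα : -1 < α) (hβ : -1 < β) [IsFiniteMeasure (jacobiMeasure α β)]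
    (c : ℕ → ℝ) {G : ℝ → ℝ} (hG : ContDiff ℝ (⊤:ℕ∞) G) (x : ℝ) : e0 α β c (FF α β G) x = 0 := by
  unfold e0
  split_ifs with h
  · have h1 := ip_lam α β hα hβ c (contDiff_infty.1 hG 2) 0
    have h2 : lam α β 0 = 0 := by simp [lam]
    have h3 : ip α β c (FF α β G) 0 = 0 := by
      rw [h2, zero_mul] at h1
      simp only [ip, FF, h]
      refine Eq.trans ?_ h1.symm
      rw [← integral_neg]
      congr 1
      ext t
      ring
    rw [h3, zero_mul]
  · rfl

lemma deriv_U (α β : ℝ) (hα : -1 < α) (hβ : -1 < β) [IsFiniteMeasure (jacobiMeasure α β)]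
    (c : ℕ → ℝ) (hc : JacobiNormalized α β c) {G : ℝ → ℝ} (hG : ContDiff ℝ (⊤:ℕ∞) G) 
    {θ₀ : ℝ} (hθ : θ₀ ∈ Ioo 0 π) :
    deriv (jacobiInvOp α β c (ff α β G)) θ₀ = deriv G (Real.cos θ₀) * -Real.sin θ₀ := by
  have hG2 := contDiff_infty.1 hG 2
  have hf : ∀ θ ∈ Ioo 0 π, ff α β G θ = FF α β G (Real.cos θ) := by
    intro t ht
    simp only [ff]
    rw [min_eq_left ht.2.le, max_eq_right ht.1.le]
  have h1 := lipsch α β hα hβ c hc (contDiff_infty.1 (FF_contDiff α β hG) 2) hG2 hf hθ 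
    (lt_add_one (wt α β θ₀)⁻¹)
  have h2 : ∀ t, FF α β G (Real.cos t) - e0 α β c (FF α β G) (Real.cos t) -
      (-EE α β (deriv G) (Real.cos t) + jacobiTau α β^2 * G (Real.cos t)) = 0 := by
    intro t; rw [e0_FF α β hα hβ c hG, FF]; ring
  simp only [h2, abs_zero, integral_zero, mul_zero, zero_mul, abs_nonpos_iff] at h1
  have h3 : jacobiInvOp α β c (ff α β G) =ᶠ[nhds θ₀] 
      fun θ => G (Real.cos θ) + (jacobiInvOp α β c (ff α β G) θ₀ - G (Real.cos θ₀)) := by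
    filter_upwards [h1] with t ht
    linarith
  rw [h3.deriv_eq, deriv_add_const]
  exact ((hG2.differentiable (by simp) (Real.cos θ₀)).hasDerivAt.comp θ₀ (Real.hasDerivAt_cos θ₀)).deriv

lemma red (α β : ℝ) (hα : -1 < α) (hβ : -1 < β) [IsFiniteMeasure (jacobiMeasure α β)]
    (c : ℕ → ℝ) (hc : JacobiNormalized α β c) {C : ℝ} (hC : ∀ f : ℝ → ℝ, IsCcSmooth f →
      ∫ θ in Set.Ioo 0 (π/4), |opT1 α β c f θ| ∂(jacobiMeasure α β) ≤
        C * ∫ θ, |f θ| ∂(jacobiMeasure α β)) {G : ℝ → ℝ} (hG : ContDiff ℝ (⊤:ℕ∞) G) (hs : tsupport G ⊆ Ioo (-1) 1) :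
    ∫ θ in Ioo 0 (π/4), wt α β θ * ((1 + Real.cos θ) * |deriv G (Real.cos θ)|) ≤
      C * ∫ θ in Ioo 0 π, wt α β θ * |FF α β G (Real.cos θ)| := by
  have hpi := Real.pi_pos
  have h := hC _ (ff_smooth α β hG hs)
  have hsub : Ioo 0 (π/4) ⊆ Ioo 0 π := fun x hx => ⟨hx.1, by linarith [hx.2]⟩
  rw [setIntegral_jm α β _ _ measurableSet_Ioo hsub, integral_jm] at h
  convert h using 1
  · refine setIntegral_congr_fun measurableSet_Ioo fun θ hθ => ?_
    have s := sin_half_pos (hsub hθ)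
    have cc := cos_half_pos (hsub hθ)
    have e1 : Real.sin θ = 2 * Real.sin (θ/2) * Real.cos (θ/2) := by
      rw [← Real.sin_two_mul]; congr 1; ring
    have e2 : Real.cos θ = 2 * Real.cos (θ/2)^2 - 1 := by
      rw [← Real.cos_two_mul]; congr 1; ring
    simp only [opT1]
    rw [deriv_U α β hα hβ c hc hG (hsub hθ), Real.cot_eq_cos_div_sin]
    have : Real.cos (θ/2) / Real.sin (θ/2) * (deriv G (Real.cos θ) * -Real.sin θ) = 
        -((1 + Real.cos θ) * deriv G (Real.cos θ)) := by
      rw [e1, show 1 + Real.cos θ = 2 * Real.cos (θ/2)^2 by rw [e2]; ring]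
      field_simp
    rw [this, abs_neg, abs_mul, abs_of_nonneg (show 0 ≤ 1 + Real.cos θ by linarith [Real.neg_one_le_cos θ])]
  · congr 1
    refine setIntegral_congr_fun measurableSet_Ioo fun θ hθ => ?_
    simp only [ff]
    rw [min_eq_left hθ.2.le, max_eq_right hθ.1.le]

def TT (x : ℝ) : ℝ := -Real.log ((1 - x)/2)

def GG (α : ℝ) (ψ : ℝ → ℝ) (N : ℝ) (x : ℝ) : ℝ :=
  if x < 1 then Real.exp (α * TT x) * ψ (TT x / N) else 0

lemma TT_hasDeriv {x : ℝ} (hx : x < 1) : HasDerivAt TT (1/(1-x)) x := by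
  have h1 : HasDerivAt (fun x : ℝ => (1 - x)/2) (-1/2) x := by
    simpa using ((hasDerivAt_id x).const_sub 1).div_const 2
  have h2 : (1 - x)/2 ≠ 0 := by linarith
  have h3 : 1 - x ≠ 0 := by linarith
  have := (h1.log h2).neg
  refine HasDerivAt.congr_deriv (f := TT) this ?_
  field_simp

lemma TT_contDiffAt {x : ℝ} (hx : x < 1) : ContDiffAt ℝ (⊤:ℕ∞) TT x := by
  have h2 : (1 - x)/2 ≠ 0 := by linarith
  unfold TT
  refine ContDiffAt.neg (ContDiffAt.log ?_ h2)
  fun_prop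

lemma GG_eq (α : ℝ) (ψ : ℝ → ℝ) (N : ℝ) {x : ℝ} (hx : x < 1) : 
    GG α ψ N =ᶠ[nhds x] fun x => Real.exp (α * TT x) * ψ (TT x / N) := by
  filter_upwards [isOpen_Iio.mem_nhds hx] with t ht
  simp only [GG]; rw [if_pos (show t < 1 from ht)]

lemma GG_supp (α : ℝ) {ψ : ℝ → ℝ} (hψ : ∀ s ∉ Icc (1:ℝ) 2, ψ s = 0) {N : ℝ} (hN : 0 < N) :
    tsupport (GG α ψ N) ⊆ Icc (1 - 2*Real.exp (-N)) (1 - 2 * Real.exp (-(2*N))) := by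
  refine closure_minimal ?_ isClosed_Icc
  intro x hx
  have hx' : GG α ψ N x ≠ 0 := hx
  unfold GG at hx'
  split_ifs at hx' with h
  · have h1 : TT x / N ∈ Icc (1:ℝ) 2 := by
      by_contra h2
      rw [hψ _ h2] at hx'
      simp at hx'
    rw [mem_Icc, le_div_iff₀ hN, div_le_iff₀ hN, TT] at h1
    have h0 : 0 < (1-x)/2 := by linarith
    have h2 : (1-x)/2 ≤ Real.exp (-N) := (Real.log_le_iff_le_exp h0).1 (by linarith)
    have h3 : Real.exp (-(2*N)) ≤ (1-x)/2 := (Real.le_log_iff_exp_le h0).1 (by linarith)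
    constructor <;> linarith
  · exact absurd rfl hx'

lemma GG_contDiff (α : ℝ) {ψ : ℝ → ℝ} (hc : ContDiff ℝ (⊤:ℕ∞) ψ) (hψ : ∀ s ∉ Icc (1:ℝ) 2, ψ s = 0) {N : ℝ} (hN : 0 < N) :
    ContDiff ℝ (⊤:ℕ∞) (GG α ψ N) := by
  rw [contDiff_iff_contDiffAt]
  intro x
  by_cases hx : x < 1
  · refine ContDiffAt.congr_of_eventuallyEq ?_ (GG_eq α ψ N hx)
    have hT := TT_contDiffAt hx
    refine ContDiffAt.mul ?_ ?_
    · exact (contDiffAt_const.mul hT).exp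
    · exact ContDiffAt.comp x hc.contDiffAt (hT.div_const N)
  · have h1 : x ∉ tsupport (GG α ψ N) := by
      intro h
      have := (GG_supp α hψ hN h).2
      have := Real.exp_pos (-(2*N))
      linarith
    exact contDiffAt_const.congr_of_eventuallyEq (notMem_tsupport_iff_eventuallyEq.1 h1)

lemma hd_aux (α N : ℝ) {φ : ℝ → ℝ} {d : ℝ} {x : ℝ} (hx : x < 1) (hφ : HasDerivAt φ d (TT x / N)) :
    HasDerivAt (fun x => Real.exp (α * TT x) * φ (TT x / N)) 
      (Real.exp (α * TT x) * (α * φ (TT x / N) + d / N) / (1 - x)) x := by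
  have hT := TT_hasDeriv hx
  have h1 := (hT.const_mul α).exp
  have h2 := HasDerivAt.comp x hφ (hT.div_const N)
  refine HasDerivAt.congr_deriv (h1.mul h2) ?_
  ring

lemma GG_deriv (α : ℝ) {ψ : ℝ → ℝ} (hc : ContDiff ℝ (⊤:ℕ∞) ψ) (N : ℝ) {x : ℝ} (hx : x < 1) :
    deriv (GG α ψ N) x = Real.exp (α * TT x) * (α * ψ (TT x / N) + deriv ψ (TT x / N) / N) / (1 - x) := by
  rw [(GG_eq α ψ N hx).deriv_eq]
  exact (hd_aux α N hx ((hc.differentiable (by simp)) _).hasDerivAt).deriv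

lemma GG_deriv2 (α : ℝ) {ψ : ℝ → ℝ} (hc : ContDiff ℝ (⊤:ℕ∞) ψ) (N : ℝ) {x : ℝ} (hx : x < 1) :
    deriv (deriv (GG α ψ N)) x = Real.exp (α * TT x) * 
      (α^2 * ψ (TT x / N) + 2 * α * (deriv ψ (TT x / N) / N) + deriv (deriv ψ) (TT x / N) / N^2
        + (α * ψ (TT x / N) + deriv ψ (TT x / N) / N)) / (1 - x)^2 := by
  have h0 : deriv (GG α ψ N) =ᶠ[nhds x] fun x => 
      (Real.exp (α * TT x) * (fun s => α * ψ s + deriv ψ s / N) (TT x / N)) / (1 - x) := by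
    filter_upwards [isOpen_Iio.mem_nhds hx] with t ht
    exact GG_deriv α hc N ht
  have hc1 := (contDiff_infty_iff_deriv.1 hc).2
  have d1 := ((hc.differentiable (by simp)) (TT x / N)).hasDerivAt
  have d2 := ((hc1.differentiable (by simp)) (TT x / N)).hasDerivAt
  have d3 := hd_aux α N hx ((d1.const_mul α).add (d2.div_const N))
  have h1 : 1 - x ≠ 0 := by linarith
  have d4 := (d3.div ((hasDerivAt_id x).const_sub 1) h1).deriv
  rw [h0.deriv_eq]
  refine Eq.trans d4 ?_
  simp only [id, Pi.add_apply]
  field_simp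
  ring

lemma FF_GG (α β : ℝ) {ψ : ℝ → ℝ} (hc : ContDiff ℝ (⊤:ℕ∞) ψ) (N : ℝ) {x : ℝ} (hx : x < 1) :
    FF α β (GG α ψ N) x = Real.exp (α * TT x) * (
      -(2 / (1-x)) * (N⁻¹ * (α * deriv ψ (TT x / N) + N⁻¹ * deriv (deriv ψ) (TT x / N)))
      + (α^2 * ψ (TT x / N) + 2 * α * (deriv ψ (TT x / N) * N⁻¹) + deriv (deriv ψ) (TT x / N) * (N⁻¹)^2)
      - (α + β + 1) * (α * ψ (TT x / N) + deriv ψ (TT x / N) * N⁻¹)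
      + jacobiTau α β^2 * ψ (TT x / N)) := by
  have h1 : 1 - x ≠ 0 := by linarith
  rw [FF, EE, GG_deriv2 α hc N hx, GG_deriv α hc N hx, linc, GG, if_pos hx]
  simp only [div_eq_mul_inv, ← inv_pow]
  have e : (1-x) * (1-x)⁻¹ = 1 := mul_inv_cancel₀ h1
  set v := (1-x)⁻¹
  have e' : x * v = v - 1 := by linear_combination -e
  generalize jacobiTau α β = τ
  generalize ψ (TT x * N⁻¹) = u0
  generalize deriv ψ (TT x * N⁻¹) = u1
  generalize deriv (deriv ψ) (TT x * N⁻¹) = u2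
  generalize Real.exp (α * TT x) = X
  generalize N⁻¹ = n
  have e2 : (1 - x^2) * v^2 = 2 * v - 1 := by
    linear_combination (-x*v - v + 1) * e'
  have : -((1 - x ^ 2) * (X * (α ^ 2 * u0 + 2 * α * (u1 * n) + u2 * n ^ 2 + (α * u0 + u1 * n)) * v ^ 2) + 
      (β - α - (α + β + 2) * x) * (X * (α * u0 + u1 * n) * v)) = 
      -(((1 - x ^ 2) * v^2) * (X * (α ^ 2 * u0 + 2 * α * (u1 * n) + u2 * n ^ 2 + (α * u0 + u1 * n))) + 
      ((β - α) * v - (α + β + 2) * (x * v)) * (X * (α * u0 + u1 * n))) := by ring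
  rw [this, e2, e']
  ring

lemma FF_bound (α β : ℝ) {ψ : ℝ → ℝ} (hc : ContDiff ℝ (⊤:ℕ∞) ψ) {B N : ℝ} (hN : 1 ≤ N)
    (h0 : ∀ s, |ψ s| ≤ B) (h1 : ∀ s, |deriv ψ s| ≤ B) (h2 : ∀ s, |deriv (deriv ψ) s| ≤ B)
     {x : ℝ} (hx : x < 1) (hxN : (1-x)/2 ≤ 2 * (N⁻¹)^2) :
    |FF α β (GG α ψ N) x| ≤ Real.exp (α * TT x) * (((1-x)/2)⁻¹ * (N⁻¹ * (|α| + N⁻¹)) * 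
      (B * (1 + 2 * (α^2 + 2 * |α| + 1 + |α+β+1| * (|α| + 1) + jacobiTau α β^2)))) := by
  rw [FF_GG α β hc N hx, abs_mul, abs_of_pos (Real.exp_pos _)]
  refine mul_le_mul_of_nonneg_left ?_ (Real.exp_pos _).le
  have hn0 : 0 < N⁻¹ := by positivity
  have hn1 : N⁻¹ ≤ 1 := inv_le_one_of_one_le₀ hN
  have b0 := h0 (TT x / N)
  have b1 := h1 (TT x / N)
  have b2 := h2 (TT x / N)
  have hy : 0 < (1-x)/2 := by linarith
  have ev : 2 / (1-x) = ((1-x)/2)⁻¹ := by rw [inv_div]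
  rw [ev]
  have hyv : 1 ≤ ((1-x)/2)⁻¹ * (2 * (N⁻¹)^2) := by
    rw [inv_mul_eq_div, le_div_iff₀ hy]; linarith
  have hv : 0 < ((1-x)/2)⁻¹ := by positivity
  generalize ((1-x)/2)⁻¹ = v at *
  generalize ψ (TT x / N) = u0 at *
  generalize deriv ψ (TT x / N) = u1 at *
  generalize deriv (deriv ψ) (TT x / N) = u2 at *
  generalize N⁻¹ = n at *
  generalize jacobiTau α β = τ at *
  have hB : 0 ≤ B := (abs_nonneg _).trans b0
  set L := α^2 + 2 * |α| + 1 + |α+β+1| * (|α| + 1) + τ^2 with hL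
  have hL0 : 0 ≤ L := by positivity
  have t1 : |-v * (n * (α * u1 + n * u2))| ≤ v * (n * (|α| * B + n * B)) := by
    rw [abs_mul, abs_neg, abs_of_pos hv, abs_mul, abs_of_pos hn0]
    gcongr
    refine (abs_add_le _ _).trans ?_
    rw [abs_mul, abs_mul, abs_of_pos hn0]
    gcongr
  have p1 : |α * u0 + u1 * n| ≤ |α| * B + B := by
    refine (abs_add_le _ _).trans ?_
    rw [abs_mul, abs_mul, abs_of_pos hn0]
    have : |u1| * n ≤ B * 1 := by gcongr
    have : |α| * |u0| ≤ |α| * B := by gcongr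
    linarith
  have t2 : |α^2 * u0 + 2 * α * (u1 * n) + u2 * n^2| ≤ α^2 * B + 2 * |α| * B + B := by
    refine (abs_add_le _ _).trans (add_le_add ((abs_add_le _ _).trans (add_le_add ?_ ?_)) ?_)
    · rw [abs_mul, abs_of_nonneg (sq_nonneg α)]; gcongr
    · rw [abs_mul, abs_mul, abs_mul, abs_of_pos hn0, abs_of_pos (zero_lt_two' ℝ)]
      have : |u1| * n ≤ B * 1 := by gcongr
      rw [mul_one] at this
      gcongr
    · rw [abs_mul, abs_of_nonneg (sq_nonneg n)]
      have : n^2 ≤ 1 := pow_le_one₀ hn0.le hn1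
      have : |u2| * n^2 ≤ B * 1 := by gcongr
      linarith
  have t3 : |(α+β+1) * (α * u0 + u1 * n)| ≤ |α+β+1| * (|α| * B + B) := by
    rw [abs_mul]; gcongr
  have t4 : |τ^2 * u0| ≤ τ^2 * B := by
    rw [abs_mul, abs_of_nonneg (sq_nonneg τ)]; gcongr
  have tot : |-v * (n * (α * u1 + n * u2)) + (α^2 * u0 + 2 * α * (u1 * n) + u2 * n^2)
      - (α+β+1) * (α * u0 + u1 * n) + τ^2 * u0| ≤ v * (n * (|α| * B + n * B)) + B * L := by
    refine (abs_add_le _ _).trans ?_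
    refine (add_le_add_left (abs_sub _ _) _).trans ?_
    refine (add_le_add_left (add_le_add_left (abs_add_le _ _) _) _).trans ?_
    rw [hL]
    linarith
  refine tot.trans ?_
  have f1 : B * L * 1 ≤ B * L * (v * (2 * n^2)) := by gcongr
  have f2 : v * (n * n) ≤ v * (n * (|α| + n)) := by 
    gcongr
    linarith [abs_nonneg α]
  have f3 : (2 * (B * L)) * (v * (n * n)) ≤ (2 * (B * L)) * (v * (n * (|α| + n))) := by gcongr
  linarith

def cs (θ : ℝ) : ℝ := Real.cos (θ/2) / Real.sin (θ/2)

lemma y_eq (θ : ℝ) : (1 - Real.cos θ)/2 = Real.sin (θ/2)^2 := by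
  have e2 : Real.cos θ = 2 * Real.cos (θ/2)^2 - 1 := by
    rw [← Real.cos_two_mul]; congr 1; ring
  rw [e2]; linarith [Real.sin_sq_add_cos_sq (θ/2)]

lemma onep_eq (θ : ℝ) : 1 + Real.cos θ = 2 * Real.cos (θ/2)^2 := by
  have e2 : Real.cos θ = 2 * Real.cos (θ/2)^2 - 1 := by
    rw [← Real.cos_two_mul]; congr 1; ring
  rw [e2]; ring

lemma TT_cos (θ : ℝ) : TT (Real.cos θ) = -(2 * Real.log (Real.sin (θ/2))) := by
  rw [TT, y_eq, Real.log_pow]; norm_num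

lemma cos_lt_one' {θ : ℝ} (hθ : θ ∈ Ioo 0 π) : Real.cos θ < 1 := by
  have := y_eq θ
  have := sq_pos_of_pos (sin_half_pos hθ)
  linarith

lemma wexp (α β : ℝ) {θ : ℝ} (hθ : θ ∈ Ioo 0 π) :
    wt α β θ * (Real.exp (α * TT (Real.cos θ)) * ((1 - Real.cos θ)/2)⁻¹) = 
      cs θ * (Real.cos (θ/2)^2) ^ β := by
  have hs := sin_half_pos hθ
  have hk := cos_half_pos hθ
  rw [TT_cos, y_eq, wt, cs]
  set s := Real.sin (θ/2)
  set k := Real.cos (θ/2)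
  have a1 : Real.exp (α * -(2 * Real.log s)) = s ^ (-(2*α)) := by
    rw [Real.rpow_def_of_pos hs]; congr 1; ring
  have a2 : s ^ (2*α+1) = s ^ (2*α) * s := by rw [Real.rpow_add_one hs.ne']
  have a3 : k ^ (2*β+1) = (k^2)^β * k := by
    rw [Real.rpow_add_one hk.ne', Real.rpow_mul hk.le]; norm_num
  have a4 : s ^ (2*α) * s ^ (-(2*α)) = 1 := by rw [← Real.rpow_add hs]; simp
  rw [a1, a2, a3]
  calc _ = (s ^ (2*α) * s ^ (-(2*α))) * (s * (s^2)⁻¹) * ((k^2)^β * k) := by ring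
    _ = _ := by
      rw [a4, one_mul, show s * (s^2)⁻¹ = s⁻¹ by field_simp]; ring

def av (p : ℝ) : ℝ := 2 * Real.arcsin (Real.exp (-p/2))

lemma exp_mem {p : ℝ} (hp : 0 < p) : Real.exp (-p/2) ∈ Ioo (0:ℝ) 1 := 
  ⟨Real.exp_pos _, by rw [← Real.exp_zero]; exact Real.exp_lt_exp.2 (by linarith)⟩

lemma av_mem {p : ℝ} (hp : 0 < p) : av p ∈ Ioo 0 π := by
  obtain ⟨h1, h2⟩ := exp_mem hp
  have h3 := Real.arcsin_pos.2 h1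
  have h4 := Real.arcsin_lt_pi_div_two.2 h2
  unfold av
  constructor <;> linarith

lemma sin_av {p : ℝ} (hp : 0 < p) : Real.sin (av p / 2) = Real.exp (-p/2) := by
  obtain ⟨h1, h2⟩ := exp_mem hp
  rw [av, mul_div_cancel_left₀ _ (two_ne_zero), Real.sin_arcsin (by linarith) h2.le]

lemma av_anti {p q : ℝ} (hpq : p ≤ q) : av q ≤ av p := by
  unfold av
  have := Real.monotone_arcsin (Real.exp_le_exp.2 (show -q/2 ≤ -p/2 by linarith))
  linarith

lemma le_av {p θ : ℝ} (hp : 0 < p) (hθ : θ ∈ Ioo 0 π) : θ ≤ av p ↔ p ≤ TT (Real.cos θ) := by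
  obtain ⟨h1, h2⟩ := exp_mem hp
  have hs := sin_half_pos hθ
  have := Real.le_arcsin_iff_sin_le (x := θ/2) (y := Real.exp (-p/2)) 
    ⟨by linarith [hθ.1, Real.pi_pos], by linarith [hθ.2]⟩ ⟨by linarith, by linarith⟩
  rw [← Real.log_le_iff_le_exp hs] at this
  rw [TT_cos, av]
  constructor
  · intro h; have := this.1 (by linarith); linarith
  · intro h; have := this.2 (by linarith); linarith

lemma av_le {p θ : ℝ} (hp : 0 < p) (hθ : θ ∈ Ioo 0 π) : av p ≤ θ ↔ TT (Real.cos θ) ≤ p := by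
  obtain ⟨h1, h2⟩ := exp_mem hp
  have hs := sin_half_pos hθ
  have := Real.arcsin_le_iff_le_sin (x := Real.exp (-p/2)) (y := θ/2) 
    ⟨by linarith, by linarith⟩ ⟨by linarith [hθ.1, Real.pi_pos], by linarith [hθ.2]⟩ 
  rw [← Real.le_log_iff_exp_le hs] at this
  rw [TT_cos, av]
  constructor
  · intro h; have := this.1 (by linarith); linarith
  · intro h; have := this.2 (by linarith); linarith

lemma Icc_av_sub {p q : ℝ} (hp : 0 < p) (hpq : p ≤ q) : Icc (av q) (av p) ⊆ Ioo 0 π := fun θ hθ =>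
  ⟨(av_mem (hp.trans_le hpq)).1.trans_le hθ.1, hθ.2.trans_lt (av_mem hp).2⟩

lemma cs_int {p q : ℝ} (hp : 0 < p) (hpq : p ≤ q) : 
    IntegrableOn cs (Icc (av q) (av p)) ∧ ∫ θ in Icc (av q) (av p), cs θ = q - p := by
  have hsub := Icc_av_sub hp hpq
  have hcont : ContinuousOn cs (Icc (av q) (av p)) := by
    unfold cs
    refine ContinuousOn.div (by fun_prop) (by fun_prop) fun θ hθ => (sin_half_pos (hsub hθ)).ne'
  have hle := av_anti hpq
  refine ⟨hcont.integrableOn_Icc, ?_⟩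
  rw [integral_Icc_eq_integral_Ioc, ← intervalIntegral.integral_of_le hle]
  have h := intervalIntegral.integral_eq_sub_of_hasDerivAt (a := av q) (b := av p) 
    (f := fun θ => 2 * Real.log (Real.sin (θ/2))) (f' := cs) ?_ ?_
  · rw [h, sin_av hp, sin_av (hp.trans_le hpq), Real.log_exp, Real.log_exp]; ring
  · intro θ hθ
    rw [uIcc_of_le hle] at hθ
    have hs := sin_half_pos (hsub hθ)
    have hh : HasDerivAt (fun θ : ℝ => θ/2) (1/2) θ := (hasDerivAt_id θ).div_const 2
    refine ((hh.sin.log hs.ne').const_mul 2).congr_deriv ?_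
    rw [cs]; ring
  · refine ContinuousOn.intervalIntegrable ?_
    rwa [uIcc_of_le hle]

lemma exp_small {N : ℝ} (hN : 8 ≤ N) : Real.exp (-N) ≤ 2 * (N⁻¹)^2 ∧ Real.exp (-N) ≤ 1/32 := by
  have h1 : N^2/2 ≤ Real.exp N := by
    have := Real.quadratic_le_exp_of_nonneg (show 0 ≤ N by linarith)
    linarith
  have hN0 : 0 < N^2/2 := by positivity
  have h2 : Real.exp (-N) ≤ 2 * (N⁻¹)^2 := by
    rw [Real.exp_neg]
    calc _ ≤ (N^2/2)⁻¹ := by gcongr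
      _ = _ := by rw [inv_div, inv_pow]; rfl
  refine ⟨h2, h2.trans ?_⟩
  have h3 : N⁻¹ ≤ 8⁻¹ := by gcongr
  have h4 : 0 ≤ N⁻¹ := by positivity
  nlinarith

/-- y small on the support -/
lemma y_small {N θ : ℝ} (hθ : θ ∈ Ioo 0 π) (h : N ≤ TT (Real.cos θ)) : (1 - Real.cos θ)/2 ≤ Real.exp (-N) := by
  have h0 : 0 < (1 - Real.cos θ)/2 := by rw [y_eq]; exact sq_pos_of_pos (sin_half_pos hθ)
  rw [TT] at h
  exact (Real.log_le_iff_le_exp h0).1 (by linarith)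

lemma rhs_bound (α β : ℝ) (hβ : -1 < β) {ψ : ℝ → ℝ} (hc : ContDiff ℝ (⊤:ℕ∞) ψ) (hψ : ∀ s ∉ Icc (1:ℝ) 2, ψ s = 0)
    {B : ℝ} (h0 : ∀ s, |ψ s| ≤ B) (h1 : ∀ s, |deriv ψ s| ≤ B) (h2 : ∀ s, |deriv (deriv ψ) s| ≤ B) 
    {N : ℝ} (hN : 8 ≤ N) :
    ∫ θ in Ioo 0 π, wt α β θ * |FF α β (GG α ψ N) (Real.cos θ)| ≤ 
      (2 * (B * (1 + 2 * (α^2 + 2 * |α| + 1 + |α+β+1| * (|α| + 1) + jacobiTau α β^2)))) * (|α| + N⁻¹) := by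
  set K := B * (1 + 2 * (α^2 + 2 * |α| + 1 + |α+β+1| * (|α| + 1) + jacobiTau α β^2)) with hK
  have hB : 0 ≤ B := (abs_nonneg _).trans (h0 0)
  have hK0 : 0 ≤ K := by positivity
  have hN0 : 0 < N := by linarith
  have hsub := Icc_av_sub hN0 (show N ≤ 2*N by linarith)
  obtain ⟨ii, ie⟩ := cs_int hN0 (show N ≤ 2*N by linarith)
  obtain ⟨es1, es2⟩ := exp_small hN
  have hpt : ∀ θ ∈ Ioo 0 π, wt α β θ * |FF α β (GG α ψ N) (Real.cos θ)| ≤ 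
      (Icc (av (2*N)) (av N)).indicator (fun θ => (2 * K * (N⁻¹ * (|α| + N⁻¹))) * cs θ) θ := by
    intro θ hθ
    have hw := wt_pos α β hθ
    by_cases hm : θ ∈ Icc (av (2*N)) (av N)
    · rw [indicator_of_mem hm]
      have hT1 := (le_av hN0 hθ).1 hm.2
      have hy := y_small hθ hT1
      have hb := FF_bound α β hc (show 1 ≤ N by linarith) h0 h1 h2 (cos_lt_one' hθ) (hy.trans es1)
      rw [← hK] at hb
      have hcs : 0 ≤ cs θ := (div_pos (cos_half_pos hθ) (sin_half_pos hθ)).le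
      have hk2 : 1/2 ≤ Real.cos (θ/2)^2 := by
        have := onep_eq θ; linarith
      have hk3 : (Real.cos (θ/2)^2) ^ β ≤ 2 := by
        have a1 : Real.cos (θ/2)^2 ≤ 1 := by nlinarith [Real.sin_sq_add_cos_sq (θ/2), sq_nonneg (Real.sin (θ/2))]
        have a2 : (Real.cos (θ/2)^2) ^ β ≤ (Real.cos (θ/2)^2) ^ (-1:ℝ) := 
          Real.rpow_le_rpow_of_exponent_ge (by linarith) a1 hβ.le
        refine a2.trans ?_
        rw [Real.rpow_neg_one]
        calc _ ≤ (1/2:ℝ)⁻¹ := by gcongr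
          _ = 2 := by norm_num
      calc _ ≤ wt α β θ * (Real.exp (α * TT (Real.cos θ)) * (((1 - Real.cos θ)/2)⁻¹ * (N⁻¹ * (|α| + N⁻¹)) * K)) := by gcongr
        _ = (wt α β θ * (Real.exp (α * TT (Real.cos θ)) * ((1 - Real.cos θ)/2)⁻¹)) * ((N⁻¹ * (|α| + N⁻¹)) * K) := by ring
        _ = cs θ * (Real.cos (θ/2)^2) ^ β * ((N⁻¹ * (|α| + N⁻¹)) * K) := by rw [wexp α β hθ]
        _ ≤ cs θ * 2 * ((N⁻¹ * (|α| + N⁻¹)) * K) := by gcongr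
        _ = _ := by ring
    · rw [indicator_of_notMem hm]
      have hx : Real.cos θ ∉ tsupport (GG α ψ N) := by
        intro h
        obtain ⟨g1, g2⟩ := GG_supp α hψ hN0 h
        have hy0 : 0 < (1 - Real.cos θ)/2 := by rw [y_eq]; exact sq_pos_of_pos (sin_half_pos hθ)
        refine hm ⟨(av_le (by linarith) hθ).2 ?_, (le_av hN0 hθ).2 ?_⟩
        · have := (Real.le_log_iff_exp_le hy0).2 (show Real.exp (-(2*N)) ≤ _ by linarith)
          rw [TT]; linarith
        · have := (Real.log_le_iff_le_exp hy0).2 (show _ ≤ Real.exp (-N) by linarith)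
          rw [TT]; linarith
      rw [FF_zero α β hx]; simp
  calc _ ≤ ∫ θ in Ioo 0 π, (Icc (av (2*N)) (av N)).indicator (fun θ => (2 * K * (N⁻¹ * (|α| + N⁻¹))) * cs θ) θ := by
        refine integral_mono_of_nonneg ?_ ?_ ?_
        · filter_upwards [ae_restrict_mem measurableSet_Ioo] with θ hθ
          exact mul_nonneg (wt_pos α β hθ).le (abs_nonneg _)
        · exact ((integrable_indicator_iff measurableSet_Icc).2 (ii.const_mul _)).restrict
        · filter_upwards [ae_restrict_mem measurableSet_Ioo] with θ hθ using hpt θ hθ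
    _ = ∫ θ in Icc (av (2*N)) (av N), (2 * K * (N⁻¹ * (|α| + N⁻¹))) * cs θ := by
        rw [setIntegral_indicator measurableSet_Icc, inter_eq_self_of_subset_right hsub]
    _ = _ := by
        rw [integral_const_mul, ie]
        field_simp
        ring

lemma lhs_bound (α β : ℝ) (hβ : -1 < β) [IsFiniteMeasure (jacobiMeasure α β)]
    {ψ : ℝ → ℝ} (hc : ContDiff ℝ (⊤:ℕ∞) ψ) (hψ : ∀ s ∉ Icc (1:ℝ) 2, ψ s = 0)
    {N m : ℝ} (hN : 8 ≤ N) (hm : ∀ s ∈ Icc (5/4:ℝ) (7/4), m ≤ |α * ψ s + deriv ψ s / N|) (hm0 : 0 ≤ m) :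
    (1/2:ℝ)^(β+1) * m * (N/2) ≤ 
    ∫ θ in Ioo 0 (π/4), wt α β θ * ((1 + Real.cos θ) * |deriv (GG α ψ N) (Real.cos θ)|) := by
  have hpi := Real.pi_pos
  have hN0 : 0 < N := by linarith
  have hp : 0 < 5*N/4 := by linarith
  have hpq : 5*N/4 ≤ 7*N/4 := by linarith
  have hsub0 := Icc_av_sub hp hpq
  obtain ⟨ii, ie⟩ := cs_int hp hpq
  obtain ⟨es1, es2⟩ := exp_small hN
  have hsub : Icc (av (7*N/4)) (av (5*N/4)) ⊆ Ioo 0 (π/4) := by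
    intro θ hθ
    have hθ' := hsub0 hθ
    refine ⟨hθ'.1, ?_⟩
    by_contra h
    push Not at h
    have hy := y_small (N := N) hθ' (by have := (le_av hp hθ').1 hθ.2; linarith)
    have h3 : Real.cos θ ≤ Real.cos (π/4) := 
      Real.cos_le_cos_of_nonneg_of_le_pi (by linarith) hθ'.2.le h
    rw [Real.cos_pi_div_four] at h3
    have : Real.sqrt 2 < 3/2 := by
      rw [Real.sqrt_lt' (by norm_num)]; norm_num
    linarith
  have hsub1 : Ioo 0 (π/4) ⊆ Ioo 0 π := fun x hx => ⟨hx.1, by linarith [hx.2]⟩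
  have hG := GG_contDiff α hc hψ hN0
  have cG' := ((contDiff_infty_iff_deriv.1 hG).2).continuous
  have hint : IntegrableOn (fun θ => wt α β θ * ((1 + Real.cos θ) * |deriv (GG α ψ N) (Real.cos θ)|)) (Ioo 0 π) :=
    (integrable_jm α β _).1 (integrable_cos α β (h := fun x => (1 + x) * |deriv (GG α ψ N) x|) (by fun_prop))
  have hpt : ∀ θ ∈ Icc (av (7*N/4)) (av (5*N/4)), (1/2:ℝ)^(β+1) * m * cs θ ≤ 
      wt α β θ * ((1 + Real.cos θ) * |deriv (GG α ψ N) (Real.cos θ)|) := by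
    intro θ hθ
    have hθ' := hsub0 hθ
    have hT1 := (le_av hp hθ').1 hθ.2
    have hT2 := (av_le (by linarith) hθ').1 hθ.1
    have hy := y_small (N := N) hθ' (by linarith)
    have hk2 : 1/2 ≤ Real.cos (θ/2)^2 := by
      have := onep_eq θ; linarith
    have hx := cos_lt_one' hθ'
    have hms := hm (TT (Real.cos θ) / N) ⟨by rw [le_div_iff₀ hN0]; linarith, by rw [div_le_iff₀ hN0]; linarith⟩
    have hcs : 0 ≤ cs θ := (div_pos (cos_half_pos hθ') (sin_half_pos hθ')).le
    rw [GG_deriv α hc N hx, abs_div, abs_mul, abs_of_pos (Real.exp_pos _), abs_of_pos (show 0 < 1 - Real.cos θ by linarith),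
      onep_eq]
    set W := |α * ψ (TT (Real.cos θ) / N) + deriv ψ (TT (Real.cos θ) / N) / N|
    have e : wt α β θ * (2 * Real.cos (θ/2)^2 * (Real.exp (α * TT (Real.cos θ)) * W / (1 - Real.cos θ))) = 
        (wt α β θ * (Real.exp (α * TT (Real.cos θ)) * ((1 - Real.cos θ)/2)⁻¹)) * Real.cos (θ/2)^2 * W := by
      rw [inv_div]; ring
    have e2 : (Real.cos (θ/2)^2)^(β+1) = (Real.cos (θ/2)^2)^β * Real.cos (θ/2)^2 := 
      Real.rpow_add_one (by linarith) β
    rw [e, wexp α β hθ']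
    have e3 : (1/2:ℝ)^(β+1) ≤ (Real.cos (θ/2)^2)^(β+1) := 
      Real.rpow_le_rpow (by norm_num) hk2 (by linarith)
    calc _ ≤ (Real.cos (θ/2)^2)^(β+1) * W * cs θ := by gcongr
      _ = _ := by rw [e2]; ring
  calc _ = ∫ θ in Icc (av (7*N/4)) (av (5*N/4)), (1/2:ℝ)^(β+1) * m * cs θ := by
        rw [integral_const_mul, ie]; ring
    _ ≤ ∫ θ in Icc (av (7*N/4)) (av (5*N/4)), wt α β θ * ((1 + Real.cos θ) * |deriv (GG α ψ N) (Real.cos θ)|) := 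
        setIntegral_mono_on (ii.const_mul _) (hint.mono_set hsub0) measurableSet_Icc hpt
    _ ≤ _ := by
        refine setIntegral_mono_set (hint.mono_set hsub1) ?_ (Eventually.of_forall hsub)
        filter_upwards [ae_restrict_mem measurableSet_Ioo] with θ hθ
        have := Real.neg_one_le_cos θ
        exact mul_nonneg (wt_pos α β (hsub1 hθ)).le (mul_nonneg (by linarith) (abs_nonneg _))

lemma part2_aux (α β : ℝ) (hα : -1 < α) (hβ : -1 < β) [IsFiniteMeasure (jacobiMeasure α β)]
    (c : ℕ → ℝ) (hc : JacobiNormalized α β c) {C : ℝ} (hC : ∀ f : ℝ → ℝ, IsCcSmooth f →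
      ∫ θ in Set.Ioo 0 (π/4), |opT1 α β c f θ| ∂(jacobiMeasure α β) ≤
        C * ∫ θ, |f θ| ∂(jacobiMeasure α β)) 
    {ψ : ℝ → ℝ} (hs : ContDiff ℝ (⊤:ℕ∞) ψ) (hψ : ∀ s ∉ Icc (1:ℝ) 2, ψ s = 0) :
    ∃ K : ℝ, 0 ≤ K ∧ ∀ N m : ℝ, 8 ≤ N → 0 ≤ m → 
      (∀ s ∈ Icc (5/4:ℝ) (7/4), m ≤ |α * ψ s + deriv ψ s / N|) → m * N ≤ K * (|α| + N⁻¹) := by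
  have hcs : HasCompactSupport ψ := HasCompactSupport.intro isCompact_Icc hψ
  have hs1 := (contDiff_infty_iff_deriv.1 hs).2
  have hs2 := (contDiff_infty_iff_deriv.1 hs1).2
  obtain ⟨B0, h0⟩ := hs.continuous.bounded_above_of_compact_support hcs
  obtain ⟨B1, h1⟩ := hs1.continuous.bounded_above_of_compact_support hcs.deriv
  obtain ⟨B2, h2⟩ := hs2.continuous.bounded_above_of_compact_support hcs.deriv.deriv
  set B := max B0 (max B1 B2)
  have h0' : ∀ s, |ψ s| ≤ B := fun s => (h0 s).trans (le_max_left _ _)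
  have h1' : ∀ s, |deriv ψ s| ≤ B := fun s => (h1 s).trans ((le_max_left _ _).trans (le_max_right _ _))
  have h2' : ∀ s, |deriv (deriv ψ) s| ≤ B := fun s => (h2 s).trans ((le_max_right _ _).trans (le_max_right _ _))
  have hB : 0 ≤ B := (abs_nonneg _).trans (h0' 0)
  set K := 2 * (B * (1 + 2 * (α^2 + 2 * |α| + 1 + |α+β+1| * (|α| + 1) + jacobiTau α β^2))) with hK
  have hK0 : 0 ≤ K := by positivity
  set κ := (1/2:ℝ)^(β+1) with hκ
  have hκ0 : 0 < κ := by positivity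
  refine ⟨2 * |C| * K / κ, by positivity, fun N m hN hm0 hm => ?_⟩
  have hN0 : 0 < N := by linarith
  have l := lhs_bound α β hβ hs hψ hN hm hm0
  have r := rhs_bound α β hβ hs hψ h0' h1' h2' hN
  rw [← hK] at r
  have hG := GG_contDiff α hs hψ hN0
  have hts : tsupport (GG α ψ N) ⊆ Ioo (-1) 1 := by
    refine (GG_supp α hψ hN0).trans fun x hx => ⟨?_, ?_⟩
    · have := (exp_small hN).2; linarith [hx.1]
    · have := Real.exp_pos (-(2*N)); linarith [hx.2]
  have rd := red α β hα hβ c hc hC hG hts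
  have hnn : 0 ≤ ∫ θ in Ioo 0 π, wt α β θ * |FF α β (GG α ψ N) (Real.cos θ)| := 
    setIntegral_nonneg measurableSet_Ioo fun θ hθ => mul_nonneg (wt_pos α β hθ).le (abs_nonneg _)
  have : κ * m * (N/2) ≤ |C| * (K * (|α| + N⁻¹)) := by
    refine (l.trans rd).trans ((mul_le_mul_of_nonneg_right (le_abs_self C) hnn).trans ?_)
    gcongr
  have e : 2 * |C| * K / κ * (|α| + N⁻¹) = (2 * (|C| * (K * (|α| + N⁻¹)))) / κ := by ring
  rw [e, le_div_iff₀ hκ0]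
  linarith

lemma part2 (α β : ℝ) (hα : -1 < α) (hβ : -1 < β) [IsFiniteMeasure (jacobiMeasure α β)]
    (c : ℕ → ℝ) (hc : JacobiNormalized α β c) : ¬ (∃ C : ℝ, ∀ f : ℝ → ℝ, IsCcSmooth f →
      ∫ θ in Set.Ioo 0 (π/4), |opT1 α β c f θ| ∂(jacobiMeasure α β) ≤
        C * ∫ θ, |f θ| ∂(jacobiMeasure α β)) := by
  rintro ⟨C, hC⟩
  let χ : ContDiffBump (3/2:ℝ) := ⟨3/8, 1/2, by norm_num, by norm_num⟩
  have hχ : ContDiff ℝ (⊤:ℕ∞) χ := χ.contDiff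
  have hχ0 : ∀ s ∉ Icc (1:ℝ) 2, χ s = 0 := by
    intro s hs
    refine χ.zero_of_le_dist ?_
    change 1/2 ≤ |s - 3/2|
    by_contra h
    push Not at h
    rw [abs_lt] at h
    exact hs ⟨by linarith [h.1], by linarith [h.2]⟩
  have hχ1 : ∀ s ∈ Icc (5/4:ℝ) (7/4), χ =ᶠ[nhds s] fun _ => 1 := by
    intro s hs
    refine χ.eventuallyEq_one_of_mem_ball ?_
    change |s - 3/2| < 3/8
    rw [abs_lt]
    exact ⟨by linarith [hs.1], by linarith [hs.2]⟩
  by_cases ha : α = 0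
  · subst ha
    obtain ⟨K, hK0, hK⟩ := part2_aux 0 β hα hβ c hc hC (ψ := fun s => χ s * s) 
      (hχ.mul contDiff_id) (fun s hs => by simp only [hχ0 s hs, zero_mul])
    have hN : (8:ℝ) ≤ max 8 (K+1) := le_max_left _ _
    have hN2 : K + 1 ≤ max 8 (K+1) := le_max_right _ _
    set N := max 8 (K+1)
    have hN0 : 0 < N := by linarith
    have h := hK N N⁻¹ hN (by positivity) ?_
    · rw [inv_mul_cancel₀ hN0.ne', abs_zero, zero_add, ← div_eq_mul_inv, le_div_iff₀ hN0] at h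
      linarith
    · intro s hs
      have : deriv (fun s => χ s * s) s = 1 := by
        have h1 : (fun s => χ s * s) =ᶠ[nhds s] fun s => s := by
          filter_upwards [hχ1 s hs] with t ht
          rw [ht, one_mul]
        rw [h1.deriv_eq]; simp
      rw [this, zero_mul, zero_add, one_div, abs_of_pos (by positivity)]
  · obtain ⟨K, hK0, hK⟩ := part2_aux α β hα hβ c hc hC (ψ := χ) hχ hχ0
    have ha' := abs_pos.2 ha
    have hN : (8:ℝ) ≤ max 8 (K * (|α| + 1) / |α| + 1) := le_max_left _ _
    have hN2 : K * (|α| + 1) / |α| + 1 ≤ max 8 (K * (|α| + 1) / |α| + 1) := le_max_right _ _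
    set N := max 8 (K * (|α| + 1) / |α| + 1)
    have hN0 : 0 < N := by linarith
    have h := hK N |α| hN (abs_nonneg _) ?_
    · have h1 : N⁻¹ ≤ 1 := inv_le_one_of_one_le₀ (by linarith)
      have h2 : |α| * N ≤ K * (|α| + 1) := h.trans (by gcongr)
      have h3 : N ≤ K * (|α| + 1) / |α| := by rw [le_div_iff₀ ha']; linarith
      linarith
    · intro s hs
      have h1 := hχ1 s hs
      rw [h1.deriv_eq, h1.eq_of_nhds]; simp

/-- `T₁` is bounded from `L¹(dμ)` to `L¹((3π/4,π),dμ)` but unbounded from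
`L¹(dμ)` to `L¹((0,π/4),dμ)`. -/
theorem opT1_L1_bounded_near_pi_unbounded_near_zero
    (α β : ℝ) (hα : -1 < α) (hβ : -1 < β)
    (c : ℕ → ℝ) (hc : JacobiNormalized α β c) :
    (∃ C : ℝ, ∀ f : ℝ → ℝ, IsCcSmooth f →
      ∫ θ in Set.Ioo (3*π/4) π, |opT1 α β c f θ| ∂(jacobiMeasure α β) ≤
        C * ∫ θ, |f θ| ∂(jacobiMeasure α β)) ∧
    ¬ (∃ C : ℝ, ∀ f : ℝ → ℝ, IsCcSmooth f →
      ∫ θ in Set.Ioo 0 (π/4), |opT1 α β c f θ| ∂(jacobiMeasure α β) ≤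
        C * ∫ θ, |f θ| ∂(jacobiMeasure α β)) := by
  haveI := fin_meas α β hα hβ c hc
  exact ⟨part1 α β hα hβ c hc, part2 α β hα hβ c hc⟩

end
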